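/- arXiv:2111.01367 — 6 statements merged into one kernel-verified Lean document; each statement's English description precedes it below -/
import Mathlib

section
/- Let G be a connected graph and let u, v be two vertices of G. Suppose v_1, v_2, …, v_s (s ≥ 1) are vertices in N_G(v) \ (N_G(u) ∪ {u}), and let G* be the graph obtained from G by deleting the edges v v_i and adding the edges u v_i for 1 ≤ i ≤ s. Let x be the Perron vector of A(G). If x_u ≥ x_v, then ρ(G) < ρ(G*). -/
open SimpleGraph Matrix

/-- The spectral radius (largest adjacency eigenvalue) of a finite simple graph. -/
noncomputable def specRad {V : Type*} [Fintype V] (G : SimpleGraph V) : ℝ :=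
  letI : DecidableRel G.Adj := Classical.decRel _
  sSup {μ : ℝ | ∃ x : V → ℝ, x ≠ 0 ∧ G.adjMatrix ℝ *ᵥ x = μ • x}

theorem eigSet_bddAbove {V : Type*} [Fintype V] (B : Matrix V V ℝ) :
    BddAbove {μ : ℝ | ∃ x : V → ℝ, x ≠ 0 ∧ B *ᵥ x = μ • x} := by
  classical
  refine (Module.End.finite_hasEigenvalue (Matrix.toLin' B)).bddAbove.mono ?_
  rintro μ ⟨x, hx, h⟩
  exact Module.End.hasEigenvalue_of_hasEigenvector (x := x)
    ⟨Module.End.mem_eigenspace_iff.2 (by simpa using h), hx⟩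

theorem posSemidef_sSup_sub {V : Type*} [Fintype V] [DecidableEq V] (B : Matrix V V ℝ)
    (hB : B.IsHermitian) (r : ℝ)
    (hr : r = sSup {μ : ℝ | ∃ x : V → ℝ, x ≠ 0 ∧ B *ᵥ x = μ • x}) :
    (r • (1 : Matrix V V ℝ) - B).PosSemidef := by
  have hH : (r • (1 : Matrix V V ℝ) - B).IsHermitian := by
    unfold Matrix.IsHermitian at *
    simp at *
    simpa using hB
  rw [hH.posSemidef_iff_eigenvalues_nonneg]
  intro i
  have h := hH.mulVec_eigenvectorBasis i
  have hne : (hH.eigenvectorBasis i).ofLp ≠ 0 := by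
    intro h0
    have := hH.eigenvectorBasis.orthonormal.ne_zero i
    exact this (by ext j; simpa using congrFun h0 j)
  have hle : r - hH.eigenvalues i ≤ r := by
    conv_rhs => rw [hr]
    refine le_csSup (eigSet_bddAbove B) ⟨_, hne, ?_⟩
    rw [Matrix.sub_mulVec, Matrix.smul_mulVec, Matrix.one_mulVec] at h
    rw [sub_smul, ← h]
    simp
  simpa using hle

/-- Kelmans-type rotation: let `G` be connected, `v_1, …, v_s ∈ N_G(v) \\ (N_G(u) ∪ {u})` with
`s ≥ 1`, and let `G*` be obtained from `G` by deleting the edges `v v_i` and adding the edges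
`u v_i`. If the Perron vector `x` of `A(G)` satisfies `x_u ≥ x_v`, then `ρ(G) < ρ(G*)`. -/
theorem spectralRadius_lt_of_rotation
    {V : Type*} [Fintype V] (G : SimpleGraph V) [DecidableRel G.Adj]
    (hconn : G.Connected) (u v : V) (s : ℕ) (hs : 1 ≤ s)
    (f : Fin s → V) (hinj : Function.Injective f)
    (hf : ∀ i, f i ∈ G.neighborSet v ∧ f i ∉ G.neighborSet u ∧ f i ≠ u)
    (x : V → ℝ) (hpos : ∀ w, 0 < x w)
    (heig : G.adjMatrix ℝ *ᵥ x = specRad G • x)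
    (hxuv : x v ≤ x u) :
    specRad G < specRad ((G.deleteEdges {e | ∃ i, e = s(v, f i)}) ⊔
      SimpleGraph.fromEdgeSet {e | ∃ i, e = s(u, f i)}) := by
  classical
  set H := ((G.deleteEdges {e | ∃ i, e = s(v, f i)}) ⊔
      SimpleGraph.fromEdgeSet {e | ∃ i, e = s(u, f i)}) with hH
  have i0 : Fin s := ⟨0, hs⟩
  have hvS : ∀ i, G.Adj v (f i) := fun i => (hf i).1
  have huS : ∀ i, ¬ G.Adj u (f i) := fun i => (hf i).2.1
  have huf : ∀ i, f i ≠ u := fun i => (hf i).2.2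
  have hvf : ∀ i, f i ≠ v := fun i => (hvS i).ne'
  have huv : u ≠ v := fun h => huS i0 (h ▸ hvS i0)
  set g : V → ℝ := fun w => (if w = u then 1 else 0) - (if w = v then 1 else 0) with hg
  set h : V → ℝ := fun w => if ∃ i, w = f i then 1 else 0 with hh
  have hHadj : ∀ w z, H.Adj w z ↔ (G.Adj w z ∧ ¬ (w = v ∧ ∃ i, z = f i) ∧ ¬ (z = v ∧ ∃ i, w = f i))
      ∨ (w = u ∧ ∃ i, z = f i) ∨ (z = u ∧ ∃ i, w = f i) := by
    intro w z
    simp only [hH, SimpleGraph.sup_adj, SimpleGraph.deleteEdges_adj,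
      SimpleGraph.fromEdgeSet_adj, Set.mem_ofPred_eq, Sym2.eq_iff]
    constructor
    · grind
    · grind
  have hB : H.adjMatrix ℝ = G.adjMatrix ℝ + Matrix.vecMulVec g h + Matrix.vecMulVec h g := by
    ext w z
    have hsy := G.adj_comm
    simp only [Matrix.add_apply, Matrix.vecMulVec_apply, SimpleGraph.adjMatrix_apply, hHadj, hg, hh]
    by_cases hw : ∃ i, w = f i
    · obtain ⟨i, rfl⟩ := hw
      have h1 := huf i
      have h2 := hvf i
      have h3 := hvS i
      have h4 := huS i
      grind
    · by_cases hz : ∃ i, z = f i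
      · obtain ⟨i, rfl⟩ := hz
        have h1 := huf i
        have h2 := hvf i
        have h3 := hvS i
        have h4 := huS i
        grind
      · simp [hw, hz]
  have hps := posSemidef_sSup_sub (H.adjMatrix ℝ) (H.isSymm_adjMatrix) (specRad H)
    (by unfold specRad; congr!)
  by_contra hlt
  push Not at hlt
  have hhx : 0 < h ⬝ᵥ x := by
    refine Finset.sum_pos' (fun w _ => ?_) ⟨f i0, Finset.mem_univ _, ?_⟩
    · have := hpos w
      simp only [hh]; split_ifs <;> simp [this.le]
    · have : h (f i0) = 1 := by simp [hh]
      rw [this, one_mul]; exact hpos _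
  have hgx : g ⬝ᵥ x = x u - x v := by
    simp [hg, dotProduct, sub_mul, Finset.sum_sub_distrib]
  have hBx : H.adjMatrix ℝ *ᵥ x = specRad G • x + (h ⬝ᵥ x) • g + (g ⬝ᵥ x) • h := by
    rw [hB, Matrix.add_mulVec, Matrix.add_mulVec, heig, Matrix.vecMulVec_mulVec,
      Matrix.vecMulVec_mulVec]
    simp
  have hMx : (specRad H • (1 : Matrix V V ℝ) - H.adjMatrix ℝ) *ᵥ x =
      (specRad H - specRad G) • x - (h ⬝ᵥ x) • g - (g ⬝ᵥ x) • h := by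
    rw [Matrix.sub_mulVec, Matrix.smul_mulVec, Matrix.one_mulVec, hBx, sub_smul]
    abel
  have hxx : 0 ≤ x ⬝ᵥ x := Finset.sum_nonneg fun w _ => mul_self_nonneg _
  have hq : x ⬝ᵥ ((specRad H • (1 : Matrix V V ℝ) - H.adjMatrix ℝ) *ᵥ x) ≤ 0 := by
    rw [hMx]
    simp only [dotProduct_sub, dotProduct_smul, smul_eq_mul, dotProduct_comm x g,
      dotProduct_comm x h]
    have h1 : 0 ≤ g ⬝ᵥ x := by rw [hgx]; linarith
    nlinarith [mul_nonneg h1 hhx.le, mul_nonneg (sub_nonneg.2 hlt) hxx]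
  have hz : (specRad H • (1 : Matrix V V ℝ) - H.adjMatrix ℝ) *ᵥ x = 0 := by
    rw [← hps.dotProduct_mulVec_zero_iff]
    exact le_antisymm (by simpa using hq) (hps.dotProduct_mulVec_nonneg x)
  rw [hMx] at hz
  have hzu := congrFun hz u
  have gu : g u = 1 := by simp [hg, huv]
  have hu : h u = 0 := by
    simp only [hh]
    rw [if_neg]
    rintro ⟨i, hi⟩
    exact huf i hi.symm
  simp only [Pi.sub_apply, Pi.smul_apply, smul_eq_mul, gu, hu, Pi.zero_apply] at hzu
  nlinarith [mul_nonneg (sub_nonneg.2 hlt) (hpos u).le]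
end

section
/- Let G be a connected graph with a unique perfect matching M. Then G contains a cut edge uv that is an edge of M. -/
open SimpleGraph Matrix

namespace KotzigAux

/-- A list of vertices that, together with their mates, are pairwise distinct. -/
def Good {V : Type*} (m : V → V) (l : List V) : Prop :=
  l.Nodup ∧ ∀ x ∈ l, m x ∉ l

/-- `w` is reached from `u` by an alternating path (listed from the end `w` to `u`). -/
def Reach {V : Type*} (m : V → V) (S : V → V → Prop) (u w : V) : Prop :=
  ∃ l : List V, (w :: l).IsChain S ∧ Good m (w :: l) ∧ u ∈ (w :: l).getLast?

variable {V : Type*} {m : V → V} {S : V → V → Prop}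

lemma Good.sublist {l l' : List V} (h : Good m l') (hl : l.Sublist l') : Good m l :=
  ⟨h.1.sublist hl, fun x hx hmx => h.2 x (hl.subset hx) (hl.subset hmx)⟩

lemma reach_self (hne : ∀ x, m x ≠ x) (u : V) : Reach m S u u :=
  ⟨[], by simp, by simp [Good, hne], by simp⟩

lemma reach_of_suffix {u x : V} {l l' : List V} (hc : (l ++ x :: l').IsChain S)
    (hg : Good m (l ++ x :: l')) (hu : u ∈ (l ++ x :: l').getLast?) : Reach m S u x := by
  refine ⟨l', hc.right_of_append, ?_, ?_⟩
  · unfold Good at *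
    grind
  · simpa using hu

lemma good_append (hne : ∀ x, m x ≠ x) (hinv : ∀ x, m (m x) = x)
    (hsymm : ∀ x y, S x y → S (m y) (m x))
    (hcyc : ∀ a l z, ((a :: l) ++ [z]).IsChain S → Good m ((a :: l) ++ [z]) → ¬ S z a)
    {u d : V} {p : List V} (hc : (d :: p).IsChain S) (hg : Good m (d :: p))
    (hu : u ∈ (d :: p).getLast?) (hd : ¬ Reach m S u (m d)) (q : List V)
    (hqc : (q ++ [d]).IsChain S) (hqg : Good m (q ++ [d])) :
    (q ++ d :: p).IsChain S ∧ Good m (q ++ d :: p) := by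
  have hchain : (q ++ d :: p).IsChain S := by
    simpa using List.IsChain.append_overlap (l₁ := q) (l₂ := [d]) (l₃ := p) hqc
      (by simpa using hc) (by simp)
  refine ⟨hchain, ?_⟩
  induction q with
  | nil => exact hg
  | cons y q ih =>
    have hg' : Good m (q ++ d :: p) := by
      apply ih
      · exact hqc.tail
      · unfold Good at *
        grind
      · exact hchain.tail
    have h1 : y ∉ p := by
      intro hy
      obtain ⟨p2, p1, rfl⟩ := List.append_of_mem hy
      -- the cycle `q ++ d :: p2 ++ [y]`
      have hch : ((q ++ d :: p2) ++ [y]).IsChain S := by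
        refine List.IsChain.prefix hchain.tail ⟨p1, ?_⟩
        simp
      have hgg : Good m ((q ++ d :: p2) ++ [y]) := by
        refine hg'.sublist (List.IsPrefix.sublist ⟨p1, ?_⟩)
        simp
      cases q with
      | nil => exact hcyc d p2 y hch hgg (by simpa using hqc)
      | cons w q =>
        refine hcyc w (q ++ d :: p2) y hch hgg ?_
        simp only [List.cons_append] at hqc
        exact (List.isChain_cons_cons.1 hqc).1
    have h2 : m y ∉ p := by
      intro hy
      obtain ⟨p2, p1, rfl⟩ := List.append_of_mem hy
      apply hd
      refine reach_of_suffix (l := []) (l' := (q.map m).reverse ++ m y :: p1) ?_ ?_ ?_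
      · have e : [] ++ m d :: ((q.map m).reverse ++ m y :: p1) =
            (m y :: (q ++ [d]).map m).reverse ++ p1 := by simp
        rw [e]
        have hr : (m y :: (q ++ [d]).map m).reverse.IsChain S := by
          rw [List.isChain_reverse]
          have : (y :: (q ++ [d])).IsChain (fun a b => S (m b) (m a)) :=
            List.IsChain.imp (fun a b h => hsymm a b h) hqc
          have := (List.isChain_map (R := fun a b => S b a) m).2 this
          simpa using this
        have hp : (m y :: p1).IsChain S := by
          have : (m y :: p1) <:+ (y :: q ++ d :: (p2 ++ m y :: p1)) := ⟨y :: q ++ d :: p2, by simp⟩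
          exact hchain.suffix this
        have := List.IsChain.append_overlap (l₁ := ((q ++ [d]).map m).reverse) (l₂ := [m y])
          (l₃ := p1) (by simpa using hr) (by simpa using hp) (by simp)
        simpa using this
      · have hinj : Function.Injective m := fun a b h => by rw [← hinv a, h, hinv]
        have hnd : ((q ++ [d]).map m).Nodup := by
          refine List.Nodup.map hinj ?_
          unfold Good at *
          grind
        have e : [] ++ m d :: ((q.map m).reverse ++ m y :: p1) =
            ((q ++ [d]).map m).reverse ++ (m y :: p1) := by simp
        rw [e]
        refine ⟨?_, ?_⟩
        · rw [List.nodup_append]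
          refine ⟨List.nodup_reverse.2 hnd, ?_, ?_⟩
          · unfold Good at hg'
            grind
          · intro a ha b hb
            simp only [List.mem_reverse, List.mem_map] at ha
            obtain ⟨c, hc1, rfl⟩ := ha
            rintro rfl
            refine hg'.2 c ?_ ?_ <;> grind
        · intro x hx hmx
          have key : ∀ x ∈ q ++ [d], x ∉ m y :: p1 := by
            have := hg'.1
            intro x hx hx'
            grind
          have hx' : m x ∈ q ++ [d] ∨ x ∈ m y :: p1 := by
            grind
          have hmx' : x ∈ q ++ [d] ∨ m x ∈ m y :: p1 := by
            grind
          have hno := hg'.2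
          rcases hx' with h | h <;> rcases hmx' with h' | h'
          · exact hno x (by grind) (by grind)
          · exact key _ h h'
          · exact key _ h' h
          · exact hno x (by grind) (by grind)
      · rw [← List.cons_append, List.getLast?_append] at hu
        rw [List.nil_append, ← List.cons_append, List.getLast?_append]
        simpa using hu
    unfold Good at *
    have := hne y
    have := hinv
    refine ⟨?_, ?_⟩
    · grind
    · intro x hx hmx
      have := hinv x
      grind

lemma reach_closed [Finite V] [Nonempty V] (hne : ∀ x, m x ≠ x) (hinv : ∀ x, m (m x) = x)
    (hsymm : ∀ x y, S x y → S (m y) (m x))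
    (hcyc : ∀ a l z, ((a :: l) ++ [z]).IsChain S → Good m ((a :: l) ++ [z]) → ¬ S z a) :
    ∃ u, ∀ d, Reach m S u d → d ≠ u → Reach m S u (m d) := by
  obtain ⟨u, hu⟩ := Finite.exists_min (fun u => {w | Reach m S u w}.ncard)
  refine ⟨u, fun d hd hdu => ?_⟩
  by_contra hmd
  obtain ⟨p, hpc, hpg, hpu⟩ := hd
  have key : ∀ w, Reach m S d w → Reach m S u w ∧ w ≠ u := by
    rintro w ⟨l, hc, hg, hl⟩
    obtain ⟨q, hq⟩ : ∃ q, w :: l = q ++ [d] := List.mem_getLast?_eq_getLast hl |>.elim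
      fun h h' => ⟨(w :: l).dropLast, by rw [h']; exact (List.dropLast_append_getLast h).symm⟩
    rw [hq] at hc hg
    obtain ⟨h1, h2⟩ := good_append hne hinv hsymm hcyc hpc hpg hpu hmd q hc hg
    have hlast : u ∈ (q ++ d :: p).getLast? := by
      simpa using hpu
    have hup : u ∈ p := by
      have := List.mem_of_getLast? hpu
      grind
    cases q with
    | nil =>
      simp only [List.nil_append, List.cons.injEq] at hq
      obtain ⟨rfl, -⟩ := hq
      exact ⟨⟨p, hpc, hpg, hpu⟩, hdu⟩
    | cons a q =>
      simp only [List.cons_append, List.cons.injEq] at hq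
      obtain ⟨rfl, -⟩ := hq
      refine ⟨⟨q ++ d :: p, h1, h2, hlast⟩, ?_⟩
      rintro rfl
      have := h2.1
      grind
  have : {w | Reach m S d w}.ncard < {w | Reach m S u w}.ncard := by
    apply Set.ncard_lt_ncard _ (Set.toFinite _)
    refine ⟨fun w hw => (key w hw).1, fun h => ?_⟩
    exact (key u (h (reach_self hne u))).2 rfl
  exact absurd (hu d) (not_le.2 this)

/-- With a unique fixed-point free matching involution there is no alternating cycle. -/
lemma no_cycle (G : SimpleGraph V) (hinv : ∀ x, m (m x) = x) (hadj : ∀ x, G.Adj x (m x))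
    (huniq : ∀ m' : V → V, (∀ x, m' (m' x) = x) → (∀ x, G.Adj x (m' x)) → m' = m)
    (a : V) (l : List V) (z : V)
    (hc : ((a :: l) ++ [z]).IsChain (fun y w => G.Adj w (m y)))
    (hg : Good m ((a :: l) ++ [z])) : ¬ G.Adj a (m z) := by
  classical
  intro hza
  set L := (a :: l) ++ [z] with hL
  have hlen : L.length = l.length + 2 := by simp [hL]
  have hS : ∀ x ∈ L, G.Adj (L.formPerm x) (m x) := by
    intro x hx
    obtain ⟨i, hi, rfl⟩ := List.getElem_of_mem hx
    rw [List.formPerm_apply_getElem _ hg.1 i hi]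
    by_cases h : i + 1 < L.length
    · have := List.isChain_iff_getElem.1 hc i h
      simpa [Nat.mod_eq_of_lt h] using this
    · have e : i + 1 = L.length := by omega
      have h0 : (i + 1) % L.length = 0 := by rw [e, Nat.mod_self]
      have hi' : i = l.length + 1 := by omega
      subst hi'
      simp only [h0]
      simpa [hL] using hza
  set σ := L.formPerm with hσ
  have hmem : ∀ x, σ x ∈ L ↔ x ∈ L := fun x => List.formPerm_mem_iff_mem
  have hmem' : ∀ x, σ.symm x ∈ L ↔ x ∈ L := fun x => by
    rw [← hmem]; simp
  have hout : ∀ x, x ∉ L → σ x = x := fun x hx => List.formPerm_apply_of_notMem hx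
  have h := huniq (fun b => if b ∈ L then m (σ.symm b) else σ (m b)) ?_ ?_
  · have haL : a ∈ L := by simp [hL]
    have h1 := congrFun h (σ a)
    simp only [hmem, haL, if_true, Equiv.symm_apply_apply] at h1
    have h2 : σ a = a := by rw [← hinv (σ a), ← h1, hinv]
    have := (List.formPerm_apply_mem_eq_self_iff _ hg.1 a haL).1 h2
    omega
  · intro x
    by_cases hx : x ∈ L
    · have : m (σ.symm x) ∉ L := hg.2 _ ((hmem' x).2 hx)
      simp [hx, this, hinv]
    · by_cases hmx : m x ∈ L
      · simp [hx, hmem, hmx, hinv]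
      · simp [hx, hout _ hmx, hinv, hout _ hx, hmx]
  · intro x
    by_cases hx : x ∈ L
    · have := hS (σ.symm x) ((hmem' x).2 hx)
      simpa [hx] using this
    · by_cases hmx : m x ∈ L
      · have := hS _ hmx
        rw [hinv] at this
        simpa [hx] using this.symm
      · simpa [hx, hout _ hmx] using hadj x

end KotzigAux

open KotzigAux in
/-- A connected graph with a unique perfect matching `M` contains a cut edge (bridge) `uv` that
is an edge of `M`. -/
theorem exists_bridge_of_unique_perfectMatching
    {V : Type*} [Fintype V] (G : SimpleGraph V) (hconn : G.Connected)
    (M : G.Subgraph) (hM : M.IsPerfectMatching)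
    (huniq : ∀ M' : G.Subgraph, M'.IsPerfectMatching → M' = M) :
    ∃ u v : V, M.Adj u v ∧ G.IsBridge s(u, v) := by
  classical
  have hex := Subgraph.isPerfectMatching_iff.1 hM
  choose m hm hmu using hex
  simp only at hm hmu
  have hinv : ∀ x, m (m x) = x := fun x => (hmu (m x) x (hm x).symm).symm
  have hadj : ∀ x, G.Adj x (m x) := fun x => (hm x).adj_sub
  have hne : ∀ x, m x ≠ x := fun x => (hadj x).ne'
  have huniq' : ∀ m' : V → V, (∀ x, m' (m' x) = x) → (∀ x, G.Adj x (m' x)) → m' = m := by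
    intro m' h1 h2
    let M' : G.Subgraph :=
      { verts := Set.univ
        Adj := fun x y => m' x = y
        adj_sub := by rintro x y rfl; exact h2 x
        edge_vert := fun _ => Set.mem_univ _
        symm := ⟨by rintro x y rfl; exact h1 x⟩ }
    have hM' : M'.IsPerfectMatching :=
      Subgraph.isPerfectMatching_iff.2 fun x => ⟨m' x, rfl, fun y hy => Eq.symm (show m' x = y from hy)⟩
    have e := huniq M' hM'
    funext x
    have : M'.Adj x (m' x) := rfl
    rw [e] at this
    exact hmu x _ this
  set S : V → V → Prop := fun y w => G.Adj w (m y) with hSdef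
  have hsymm : ∀ x y, S x y → S (m y) (m x) := by
    intro x y h
    simp only [hSdef, hinv] at *
    exact h.symm
  have hcyc : ∀ a l z, ((a :: l) ++ [z]).IsChain S → Good m ((a :: l) ++ [z]) → ¬ S z a :=
    fun a l z hc hg => no_cycle G hinv hadj huniq' a l z hc hg
  have := hconn.nonempty
  obtain ⟨u, hu⟩ := reach_closed hne hinv hsymm hcyc
  refine ⟨u, m u, hm u, ?_⟩
  rw [isBridge_iff]
  have hclosed : ∀ w y, (G.deleteEdges {s(u, m u)}).Adj w y → Reach m S u w → Reach m S u y := by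
    intro w y hwy hw
    rw [deleteEdges_adj] at hwy
    obtain ⟨hwy, hnot⟩ := hwy
    obtain ⟨l, hc, hg, hl⟩ := hw
    have hmem : ∀ x ∈ w :: l, Reach m S u x := by
      intro x hx
      obtain ⟨l1, l2, e⟩ := List.append_of_mem hx
      rw [e] at hc hg hl
      exact reach_of_suffix hc hg hl
    by_cases hyu : m y = u
    · have hy : y = m u := by rw [← hyu, hinv]
      subst hy
      have hwu : w ≠ u := by
        rintro rfl
        simp at hnot
      exfalso
      obtain ⟨q, hq⟩ : ∃ q, w :: l = q ++ [u] := List.mem_getLast?_eq_getLast hl |>.elim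
        fun h h' => ⟨(w :: l).dropLast, by rw [h']; exact (List.dropLast_append_getLast h).symm⟩
      rw [hq] at hc hg
      cases q with
      | nil => simp at hq; exact hwu hq.1
      | cons b q =>
        simp only [List.cons_append, List.cons.injEq] at hq
        obtain ⟨rfl, -⟩ := hq
        exact hcyc w q u hc hg hwy
    · by_cases h1 : y ∈ w :: l
      · exact hmem y h1
      · have : Reach m S u (m y) := by
          by_cases h2 : m y ∈ w :: l
          · exact hmem _ h2
          · refine ⟨w :: l, ?_, ?_, ?_⟩
            · refine List.isChain_cons_cons.2 ⟨?_, hc⟩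
              simpa [hSdef, hinv] using hwy
            · refine ⟨List.nodup_cons.2 ⟨h2, hg.1⟩, ?_⟩
              intro x hx hmx
              have := hg.2 x
              have := hinv x
              have := hne x
              have := hinv y
              grind
            · simpa using hl
        have := hu _ this hyu
        rwa [hinv] at this
  rintro ⟨p⟩
  have hall : ∀ (a b : V) (p : (G.deleteEdges {s(u, m u)}).Walk a b),
      Reach m S u a → Reach m S u b := by
    intro a b p
    induction p with
    | nil => exact id
    | cons h _ ih => exact fun ha => ih (hclosed _ _ h ha)
  obtain ⟨l, -, hg, hl⟩ := hall _ _ p (reach_self hne u)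
  exact hg.2 u (List.mem_of_getLast? hl) (by simp)
end

section
/- Let G be a graph and let b be a positive odd integer. Then G contains an odd [1,b]-factor if and only if for every subset S ⊆ V(G), the number of odd components of G − S satisfies o(G − S) ≤ b|S|. -/
open SimpleGraph Matrix

/-- Degree of a vertex, via the cardinality of its neighbor set. -/
noncomputable def ndeg {V : Type*} (G : SimpleGraph V) (v : V) : ℕ :=
  (G.neighborSet v).ncard

/-- The number of odd components (components with an odd number of vertices) of the subgraph of
`G` induced on the complement of `S`, i.e. `o(G - S)`. -/
noncomputable def oddComp {V : Type*} (G : SimpleGraph V) (S : Set V) : ℕ :=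
  Nat.card {c : (G.induce Sᶜ).ConnectedComponent // Odd (Nat.card c.supp)}

/-- The clique blow-up of `G`: each vertex replaced by a clique on `b` vertices. -/
def blowUp {V : Type*} (G : SimpleGraph V) (b : ℕ) : SimpleGraph (V × Fin b) where
  Adj p q := p ≠ q ∧ (p.1 = q.1 ∨ G.Adj p.1 q.1)
  symm := ⟨fun p q h => ⟨h.1.symm, h.2.imp Eq.symm (fun h => h.symm)⟩⟩
  loopless := ⟨fun p h => h.1 rfl⟩

theorem factor_of_involution {V : Type*} [Fintype V] (G : SimpleGraph V) (b : ℕ) (hb : Odd b)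
    (g : V × Fin b → V × Fin b) (hg : ∀ p, g (g p) = p) (hadj : ∀ p, (blowUp G b).Adj p (g p)) :
    ∃ H : SimpleGraph V, H ≤ G ∧ ∀ v, Odd (ndeg H v) ∧ 1 ≤ ndeg H v ∧ ndeg H v ≤ b := by
  classical
  let A : V → V → Finset (Fin b) := fun v w => Finset.univ.filter (fun i => (g (v, i)).1 = w)
  have hsymm : ∀ v w, (A v w).card = (A w v).card := by
    intro v w
    refine Finset.card_bij' (fun i _ => (g (v, i)).2) (fun i _ => (g (w, i)).2) ?_ ?_ ?_ ?_
    · intro i hi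
      have h : (g (v, i)).1 = w := by simpa [A] using hi
      have : (w, (g (v, i)).2) = g (v, i) := Prod.ext h.symm rfl
      simp [A, this, hg]
    · intro i hi
      have h : (g (w, i)).1 = v := by simpa [A] using hi
      have : (v, (g (w, i)).2) = g (w, i) := Prod.ext h.symm rfl
      simp [A, this, hg]
    · intro i hi
      have h : (g (v, i)).1 = w := by simpa [A] using hi
      have : (w, (g (v, i)).2) = g (v, i) := Prod.ext h.symm rfl
      simp [this, hg]
    · intro i hi
      have h : (g (w, i)).1 = v := by simpa [A] using hi
      have : (v, (g (w, i)).2) = g (w, i) := Prod.ext h.symm rfl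
      simp [this, hg]
  have hdiag : ∀ v, Even (A v v).card := by
    intro v
    have : ∑ i ∈ A v v, (1 : ZMod 2) = 0 := by
      refine Finset.sum_involution (fun i _ => (g (v, i)).2) ?_ ?_ ?_ ?_
      · intro i hi; decide
      · intro i hi _ heq
        have h : (g (v, i)).1 = v := by simpa [A] using hi
        have : g (v, i) = (v, i) := Prod.ext h heq
        exact (hadj (v, i)).1 this.symm
      · intro i hi
        have h : (g (v, i)).1 = v := by simpa [A] using hi
        have : (v, (g (v, i)).2) = g (v, i) := Prod.ext h.symm rfl
        simp [A, this, hg]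
      · intro i hi
        have h : (g (v, i)).1 = v := by simpa [A] using hi
        have : (v, (g (v, i)).2) = g (v, i) := Prod.ext h.symm rfl
        simp [this, hg]
    rw [Finset.sum_const, nsmul_eq_mul, mul_one] at this
    exact (ZMod.natCast_eq_zero_iff_even).1 this
  have hsum : ∀ v, ∑ w, (A v w).card = b := by
    intro v
    have := Finset.card_eq_sum_card_fiberwise (s := (Finset.univ : Finset (Fin b)))
      (t := (Finset.univ : Finset V)) (f := fun i => (g (v, i)).1) (by simp)
    simpa [A] using this.symm
  let H : SimpleGraph V :=
    { Adj := fun v w => v ≠ w ∧ Odd (A v w).card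
      symm := ⟨fun v w h => ⟨h.1.symm, by rw [← hsymm]; exact h.2⟩⟩
      loopless := ⟨fun v h => h.1 rfl⟩ }
  refine ⟨H, ?_, ?_⟩
  · intro v w h
    obtain ⟨hne, ho⟩ := h
    obtain ⟨i, hi⟩ := Finset.card_pos.1 ho.pos
    have h : (g (v, i)).1 = w := by simpa [A] using hi
    rcases (hadj (v, i)).2 with h1 | h1
    · exact absurd (h1.trans h) hne
    · rwa [h] at h1
  · intro v
    have hn : ndeg H v = (Finset.univ.filter (fun w => Odd (A v w).card)).card := by
      unfold ndeg
      rw [← Set.ncard_coe_finset]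
      congr 1
      ext w
      simp only [mem_neighborSet, Finset.coe_filter, Finset.mem_univ, true_and, Set.mem_ofPred_eq]
      constructor
      · exact fun h => h.2
      · intro h
        refine ⟨?_, h⟩
        rintro rfl
        exact (Nat.not_odd_iff_even.2 (hdiag v)) h
    have ho : Odd (ndeg H v) := by
      rw [hn, ← Finset.odd_sum_iff_odd_card_odd, hsum]
      exact hb
    refine ⟨ho, ho.pos, ?_⟩
    rw [hn, Finset.card_eq_sum_ones, Finset.sum_filter]
    refine le_trans ?_ (hsum v).le
    refine Finset.sum_le_sum fun w _ => ?_
    split_ifs with h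
    · exact h.pos
    · exact Nat.zero_le _

theorem no_violator {V : Type*} [Fintype V] (G : SimpleGraph V) (b : ℕ)
    (h : ∀ S : Set V, oddComp G S ≤ b * Nat.card S) (u : Set (V × Fin b)) :
    ¬ (blowUp G b).IsTutteViolator u := by
  classical
  unfold IsTutteViolator
  rw [not_lt]
  let S : Set V := {v | ∀ i, (v, i) ∈ u}
  set K := ((⊤ : (blowUp G b).Subgraph).deleteVerts u).coe with hK
  have hmem : ∀ p : ((⊤ : (blowUp G b).Subgraph).deleteVerts u).verts, p.1 ∉ u := fun p => p.2.2
  let f : ((⊤ : (blowUp G b).Subgraph).deleteVerts u).verts → (Sᶜ : Set V) :=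
    fun p => ⟨p.1.1, fun hp => hmem p (hp p.1.2)⟩
  have hKadj : ∀ p q, K.Adj p q ↔ (blowUp G b).Adj p.1 q.1 := by
    intro p q
    have := hmem p
    have := hmem q
    simp [hK, Subgraph.deleteVerts_adj, *]
  have hf1 : ∀ p q, K.Reachable p q → (G.induce Sᶜ).Reachable (f p) (f q) := by
    rintro p q ⟨w⟩
    induction w with
    | nil => exact Reachable.refl _
    | @cons p q r hpq _ ih =>
      refine Reachable.trans ?_ ih
      rcases ((hKadj p q).1 hpq).2 with h1 | h1
      · have : f p = f q := Subtype.ext h1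
        rw [this]
      · exact Adj.reachable (by simpa [f] using h1)
  have hf0 : ∀ p q, f p = f q → K.Reachable p q := by
    intro p q hpq
    by_cases hpq' : p = q
    · rw [hpq']
    · exact Adj.reachable ((hKadj p q).2
        ⟨fun h => hpq' (Subtype.ext h), Or.inl (congrArg Subtype.val hpq)⟩)
  have hf2' : ∀ x y, (G.induce Sᶜ).Reachable x y → ∀ p q, f p = x → f q = y → K.Reachable p q := by
    rintro x y ⟨w⟩
    induction w with
    | nil => intro p q hp hq; exact hf0 p q (hp.trans hq.symm)
    | @cons x y z hxy _ ih =>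
      intro p q hp hq
      have : ∃ i, (y.1, i) ∉ u := by
        have hy : ¬ ∀ i, (y.1, i) ∈ u := y.2
        exact not_forall.1 hy
      obtain ⟨i, hi⟩ := this
      let r : ((⊤ : (blowUp G b).Subgraph).deleteVerts u).verts := ⟨(y.1, i), by simp [hi]⟩
      have hr : f r = y := rfl
      refine Reachable.trans ?_ (ih r q hr hq)
      have hA : G.Adj p.1.1 y.1 := by
        have : G.Adj x.1 y.1 := hxy
        rw [← hp] at this
        exact this
      refine Adj.reachable ((hKadj p r).2 ⟨?_, Or.inr hA⟩)
      intro h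
      have := congrArg Prod.fst h
      exact hA.ne this
  let F : K.ConnectedComponent → (G.induce Sᶜ).ConnectedComponent :=
    fun c => (G.induce Sᶜ).connectedComponentMk (f c.out)
  have hF : ∀ c p, p ∈ c.supp ↔ f p ∈ (F c).supp := by
    intro c p
    have hc : K.connectedComponentMk c.out = c := Quot.out_eq c
    rw [ConnectedComponent.mem_supp_iff, ConnectedComponent.mem_supp_iff]
    constructor
    · intro h
      rw [← hc] at h
      exact ConnectedComponent.sound (hf1 _ _ (ConnectedComponent.exact h))
    · intro h
      rw [← hc]
      exact ConnectedComponent.sound (hf2' _ _ (ConnectedComponent.exact h) _ _ rfl rfl)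
  have hFinj : Function.Injective F := by
    intro c d hcd
    have h1 : c.out ∈ c.supp := Quot.out_eq c
    have h2 := (hF c _).1 h1
    rw [hcd] at h2
    have h3 := (hF d _).2 h2
    exact ConnectedComponent.eq_of_common_vertex h1 h3
  have key : ∀ c : K.ConnectedComponent, Odd (Nat.card c.supp) → ¬ Odd (Nat.card (F c).supp) →
      ∃ p : V × Fin b, p ∈ u ∧ ∃ hp : p.1 ∈ Sᶜ, (⟨p.1, hp⟩ : (Sᶜ : Set V)) ∈ (F c).supp := by
    intro c hc hFc
    by_contra! hcon
    have e : c.supp ≃ (F c).supp × Fin b :=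
      { toFun := fun p => (⟨f p.1, (hF c _).1 p.2⟩, p.1.1.2)
        invFun := fun q => ⟨⟨(q.1.1.1, q.2), by
            have : (q.1.1.1, q.2) ∉ u := fun hu => hcon _ hu q.1.1.2 q.1.2
            simp [this]⟩, (hF c _).2 q.1.2⟩
        left_inv := fun p => rfl
        right_inv := fun q => rfl }
    rw [Nat.card_congr e, Nat.card_prod, Nat.odd_mul] at hc
    exact hFc hc.1
  let T : Set (V × Fin b) := {p | p ∈ u ∧ p.1 ∉ S}
  have hle : K.oddComponents.ncard ≤
      Nat.card ({c : (G.induce Sᶜ).ConnectedComponent // Odd (Nat.card c.supp)} ⊕ T) := by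
    rw [← Nat.card_coe_set_eq]
    have hodd : ∀ c : K.oddComponents, Odd (Nat.card c.1.supp) := by
      intro c
      have h0 : Odd c.1.supp.ncard := c.2
      rwa [Nat.card_coe_set_eq]
    choose! P hP1 hP2 hP3 using key
    let Φ : K.oddComponents →
        {c : (G.induce Sᶜ).ConnectedComponent // Odd (Nat.card c.supp)} ⊕ T :=
      fun c => if hc : Odd (Nat.card (F c.1).supp) then Sum.inl ⟨F c.1, hc⟩
        else Sum.inr ⟨P c.1 (hodd c) hc, hP1 _ (hodd c) hc, hP2 _ (hodd c) hc⟩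
    refine Nat.card_le_card_of_injective Φ ?_
    intro c d hcd
    by_cases hc : Odd (Nat.card (F c.1).supp) <;> by_cases hd : Odd (Nat.card (F d.1).supp)
    · simp only [Φ, hc, hd, dif_pos, Sum.inl.injEq, Subtype.mk.injEq] at hcd
      exact Subtype.ext (hFinj hcd)
    · simp only [Φ, hc, hd, dif_pos, dif_neg, not_false_eq_true, reduceCtorEq] at hcd
    · simp only [Φ, hc, hd, dif_pos, dif_neg, not_false_eq_true, reduceCtorEq] at hcd
    · simp only [Φ, hc, hd, dif_neg, not_false_eq_true, Sum.inr.injEq, Subtype.mk.injEq] at hcd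
      have h1 := hP3 _ (hodd c) hc
      have h2 := hP3 _ (hodd d) hd
      have h1' : (⟨(P d.1 (hodd d) hd).1, hP2 _ (hodd d) hd⟩ : (Sᶜ : Set V)) ∈ (F c.1).supp := by
        have he : (⟨(P d.1 (hodd d) hd).1, hP2 _ (hodd d) hd⟩ : (Sᶜ : Set V)) =
          ⟨(P c.1 (hodd c) hc).1, hP2 _ (hodd c) hc⟩ := Subtype.ext (congrArg Prod.fst hcd.symm)
        rw [he]
        exact h1
      exact Subtype.ext (hFinj (ConnectedComponent.eq_of_common_vertex h1' h2))
  refine hle.trans ?_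
  rw [Nat.card_sum]
  have h1 : Nat.card {c : (G.induce Sᶜ).ConnectedComponent // Odd (Nat.card c.supp)} ≤
    b * Nat.card S := h S
  let T' : Set (V × Fin b) := S ×ˢ Set.univ
  have hT' : T'.ncard = b * Nat.card S := by
    rw [Set.ncard_prod, Set.ncard_univ, Nat.card_fin, Nat.card_coe_set_eq, mul_comm]
  have hu : u = T' ∪ T := by
    ext p
    simp only [T', T, S, Set.mem_union, Set.mem_prod, Set.mem_univ, Set.mem_ofPred_eq, and_true]
    constructor
    · intro hp
      by_cases hS : ∀ i, (p.1, i) ∈ u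
      · exact Or.inl hS
      · exact Or.inr ⟨hp, hS⟩
    · rintro (hp | hp)
      · exact hp p.2
      · exact hp.1
  have hd : Disjoint T' T := by
    rw [Set.disjoint_left]
    rintro p hp hq
    exact hq.2 hp.1
  rw [hu, Set.ncard_union_eq hd, hT', Nat.card_coe_set_eq]
  omega

theorem factor_necessity {V : Type*} [Fintype V] (G : SimpleGraph V) (b : ℕ)
    (H : SimpleGraph V) (hHG : H ≤ G) (hodd : ∀ v, Odd (ndeg H v)) (hle : ∀ v, ndeg H v ≤ b)
    (S : Set V) : oddComp G S ≤ b * Nat.card S := by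
  classical
  have key : ∀ c : {c : (G.induce Sᶜ).ConnectedComponent // Odd (Nat.card c.supp)},
      ∃ q : (s : S) × H.neighborSet s, ∃ hq : (q.2 : V) ∈ Sᶜ,
        (⟨q.2, hq⟩ : (Sᶜ : Set V)) ∈ c.1.supp := by
    rintro ⟨c, hc⟩
    by_contra! hcon
    let C : Set V := Subtype.val '' c.supp
    have hclosed : ∀ v ∈ C, ∀ w, H.Adj v w → w ∈ C := by
      rintro _ ⟨v, hv, rfl⟩ w hvw
      by_cases hw : w ∈ S
      · exact absurd hv (hcon ⟨⟨w, hw⟩, ⟨v.1, hvw.symm⟩⟩ v.2)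
      · refine ⟨⟨w, hw⟩, ?_, rfl⟩
        have : (G.induce Sᶜ).Adj v ⟨w, hw⟩ := hHG hvw
        exact (c.mem_supp_congr_adj this).1 hv
    have hdeg : ∀ v : C, Odd ((H.induce C).degree v) := by
      intro v
      have : (H.induce C).degree v = ndeg H v := by
        unfold ndeg
        rw [← card_neighborSet_eq_degree, ← Nat.card_eq_fintype_card, ← Nat.card_coe_set_eq]
        exact Nat.card_congr
          { toFun := fun w => ⟨w.1.1, w.2⟩
            invFun := fun w => ⟨⟨w.1, hclosed _ v.2 _ w.2⟩, w.2⟩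
            left_inv := fun w => rfl
            right_inv := fun w => rfl }
      rw [this]
      exact hodd _
    have h1 := (H.induce C).even_card_odd_degree_vertices
    rw [Finset.filter_true_of_mem (fun v _ => hdeg v), Finset.card_univ,
      ← Nat.card_eq_fintype_card, Nat.card_coe_set_eq,
      Set.ncard_image_of_injective _ Subtype.val_injective, ← Nat.card_coe_set_eq] at h1
    exact (Nat.not_odd_iff_even.2 h1) hc
  choose q hq1 hq2 using key
  have hinj : Function.Injective q := by
    intro c d hcd
    have h1 := hq2 c
    have h2 := hq2 d
    have he : (⟨(q c).2, hq1 c⟩ : (Sᶜ : Set V)) = ⟨(q d).2, hq1 d⟩ := by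
      apply Subtype.ext
      change ((q c).2 : V) = (q d).2
      rw [hcd]
    rw [he] at h1
    exact Subtype.ext (ConnectedComponent.eq_of_common_vertex h1 h2)
  refine (Nat.card_le_card_of_injective q hinj).trans ?_
  rw [Nat.card_sigma, mul_comm, Nat.card_eq_fintype_card (α := S)]
  refine (Finset.sum_le_card_nsmul _ _ b fun s _ => ?_).trans (by simp)
  exact hle s.1

/-- Amahashi's theorem: for a positive odd integer `b`, a graph `G` contains an odd
`[1,b]`-factor iff `o(G - S) ≤ b·|S|` for every vertex subset `S`. -/
theorem odd_one_b_factor_iff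
    {V : Type*} [Fintype V] (G : SimpleGraph V) (b : ℕ) (hb : Odd b) :
    (∃ H : SimpleGraph V, H ≤ G ∧ ∀ v, Odd (ndeg H v) ∧ 1 ≤ ndeg H v ∧ ndeg H v ≤ b) ↔
      ∀ S : Set V, oddComp G S ≤ b * Nat.card S := by
  constructor
  · rintro ⟨H, hHG, hH⟩ S
    exact factor_necessity G b H hHG (fun v => (hH v).1) (fun v => (hH v).2.2) S
  · intro h
    obtain ⟨M, hM⟩ := (tutte (G := blowUp G b)).2 (no_violator G b h)
    rw [Subgraph.isPerfectMatching_iff] at hM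
    choose g hg1 hg2 using hM
    refine factor_of_involution G b hb g (fun p => ?_) (fun p => (hg1 p).adj_sub)
    exact (hg2 _ _ (hg1 p).symm).symm
end

section
/- Let a and b be integers with 1 ≤ a < b, and let G be a graph of order n with minimum degree δ(G) ≥ a, where n ≥ 2a + b + (a² − a)/b. If max{d_G(u), d_G(w)} ≥ an/(a+b) for every pair of nonadjacent vertices u and w of G, then G contains an [a,b]-factor. -/
open SimpleGraph Matrix

open Classical in
lemma ndeg_eq_sum {V : Type*} [Fintype V] (H : SimpleGraph V) (v : V) :
    (ndeg H v : ℤ) = ∑ w, if H.Adj v w then (1 : ℤ) else 0 := by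
  unfold ndeg
  rw [Set.ncard_eq_toFinset_card']
  simp only [Finset.sum_boole]
  congr 2
  ext w
  simp

open Classical in
lemma ndeg_add_edge {V : Type*} [Fintype V] (H K : SimpleGraph V) (x y : V) (hxy : x ≠ y)
    (hH : ¬ H.Adj x y)
    (hK : ∀ u w, K.Adj u w ↔ (H.Adj u w ∨ (u = x ∧ w = y) ∨ (u = y ∧ w = x))) (v : V) :
    (ndeg K v : ℤ) = ndeg H v + (if v = x then 1 else 0) + (if v = y then 1 else 0) := by
  rw [ndeg_eq_sum, ndeg_eq_sum]
  have h1 : (if v = x then (1 : ℤ) else 0) = ∑ w, if v = x ∧ w = y then (1 : ℤ) else 0 := by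
    by_cases h : v = x <;> simp [h]
  have h2 : (if v = y then (1 : ℤ) else 0) = ∑ w, if v = y ∧ w = x then (1 : ℤ) else 0 := by
    by_cases h : v = y <;> simp [h]
  rw [h1, h2, ← Finset.sum_add_distrib, ← Finset.sum_add_distrib]
  refine Finset.sum_congr rfl fun w _ => ?_
  have hH' : ¬ H.Adj y x := fun h => hH h.symm
  by_cases c1 : v = x ∧ w = y
  · obtain ⟨rfl, rfl⟩ := c1
    simp [hK, hH, hxy]
  · by_cases c2 : v = y ∧ w = x
    · obtain ⟨rfl, rfl⟩ := c2
      simp [hK, hH', hxy.symm]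
    · simp [hK, c1, c2]

/-- Alternating walk of length `k` from `v0`. -/
def AltW {V : Type*} (G H : SimpleGraph V) (v0 : V) (p : ℕ → V) (k : ℕ) : Prop :=
  p 0 = v0 ∧ ∀ i < k, G.Adj (p i) (p (i + 1)) ∧ (H.Adj (p i) (p (i + 1)) ↔ i % 2 = 1)

/-- The endpoint of an alternating walk can absorb the change. -/
def GoodEnd {V : Type*} (H : SimpleGraph V) (a b : ℕ) (x : V) (k : ℕ) : Prop :=
  (k % 2 = 1 ∧ ndeg H x < b) ∨ (k % 2 = 0 ∧ a < ndeg H x)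

open Classical in
lemma swap_trail {V : Type*} [Fintype V] (G H : SimpleGraph V) (hHG : H ≤ G) (v0 : V)
    (p : ℕ → V) (k : ℕ) (hp : AltW G H v0 p k)
    (hd : ∀ i j, i < j → j < k → s(p i, p (i + 1)) ≠ s(p j, p (j + 1))) :
    ∀ j ≤ k, ∃ K : SimpleGraph V, K ≤ G ∧
      (∀ u w, (∀ i < j, s(p i, p (i + 1)) ≠ s(u, w)) → (K.Adj u w ↔ H.Adj u w)) ∧
      ∀ v, (ndeg K v : ℤ) = ndeg H v + (if v = v0 then 1 else 0) +
        (if j % 2 = 1 then 1 else -1) * (if v = p j then 1 else 0) := by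
  intro j
  induction j with
  | zero =>
    intro _
    refine ⟨H, hHG, fun _ _ _ => Iff.rfl, fun v => ?_⟩
    rw [hp.1]
    by_cases h : v = v0 <;> simp [h]
  | succ j ih =>
    intro hj
    obtain ⟨K, hKG, hKH, hKd⟩ := ih (by omega)
    obtain ⟨hG, hA⟩ := hp.2 j (by omega)
    have hKA := hKH (p j) (p (j + 1)) (fun i hi => hd i j hi (by omega))
    have hne : p j ≠ p (j + 1) := hG.ne
    rcases Nat.mod_two_eq_zero_or_one j with h0 | h1
    · have hnK : ¬ K.Adj (p j) (p (j + 1)) := by rw [hKA, hA]; omega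
      let K' : SimpleGraph V :=
        { Adj := fun u w => K.Adj u w ∨ (u = p j ∧ w = p (j + 1)) ∨ (u = p (j + 1) ∧ w = p j)
          symm := ⟨by
            intro u w h
            rcases h with h | h | h
            · exact Or.inl h.symm
            · exact Or.inr (Or.inr ⟨h.2, h.1⟩)
            · exact Or.inr (Or.inl ⟨h.2, h.1⟩)⟩
          loopless := ⟨by
            intro u h
            rcases h with h | h | h
            · exact K.loopless.irrefl u h
            · exact hne (h.1.symm.trans h.2)
            · exact hne (h.2.symm.trans h.1)⟩ }
      refine ⟨K', ?_, ?_, ?_⟩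
      · intro u w h
        rcases h with h | ⟨rfl, rfl⟩ | ⟨rfl, rfl⟩
        · exact hKG h
        · exact hG
        · exact hG.symm
      · intro u w h
        have hj' := h j (by omega)
        rw [← hKH u w (fun i hi => h i (by omega))]
        constructor
        · rintro (h | ⟨rfl, rfl⟩ | ⟨rfl, rfl⟩)
          · exact h
          · exact absurd rfl hj'
          · exact absurd Sym2.eq_swap hj'
        · exact Or.inl
      · intro v
        rw [ndeg_add_edge K K' _ _ hne hnK (fun _ _ => Iff.rfl) v, hKd v]
        have : (j + 1) % 2 = 1 := by omega
        simp only [h0, this]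
        split_ifs <;> simp_all
    · have hnK : K.Adj (p j) (p (j + 1)) := by rw [hKA, hA]; omega
      let K' : SimpleGraph V :=
        { Adj := fun u w => K.Adj u w ∧ ¬ (u = p j ∧ w = p (j + 1)) ∧ ¬ (u = p (j + 1) ∧ w = p j)
          symm := ⟨by
            intro u w h
            exact ⟨h.1.symm, fun h' => h.2.2 ⟨h'.2, h'.1⟩, fun h' => h.2.1 ⟨h'.2, h'.1⟩⟩⟩
          loopless := ⟨by
            intro u h
            exact K.loopless.irrefl u h.1⟩ }
      refine ⟨K', ?_, ?_, ?_⟩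
      · intro u w h
        exact hKG h.1
      · intro u w h
        have hj' := h j (by omega)
        rw [← hKH u w (fun i hi => h i (by omega))]
        constructor
        · exact fun h => h.1
        · intro h
          refine ⟨h, ?_, ?_⟩
          · rintro ⟨rfl, rfl⟩
            exact absurd rfl hj'
          · rintro ⟨rfl, rfl⟩
            exact absurd Sym2.eq_swap hj'
      · intro v
        have := ndeg_add_edge K' K _ _ hne (fun h => h.2.1 ⟨rfl, rfl⟩) (fun u w => by
          constructor
          · intro h
            by_cases c1 : u = p j ∧ w = p (j + 1)
            · exact Or.inr (Or.inl c1)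
            · by_cases c2 : u = p (j + 1) ∧ w = p j
              · exact Or.inr (Or.inr c2)
              · exact Or.inl ⟨h, c1, c2⟩
          · rintro (h | ⟨rfl, rfl⟩ | ⟨rfl, rfl⟩)
            · exact h.1
            · exact hnK
            · exact hnK.symm) v
        rw [hKd v] at this
        have h2 : (j + 1) % 2 = 0 := by omega
        simp only [h1, h2] at this ⊢
        simp at this ⊢
        split_ifs at this ⊢ <;> linarith

open Classical in
lemma augment {V : Type*} [Fintype V] (G H : SimpleGraph V) (hHG : H ≤ G) (a b : ℕ) (hab : a < b)
    (v0 : V) (hv0 : ndeg H v0 < a)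
    (h : ∃ k p, AltW G H v0 p k ∧ GoodEnd H a b (p k) k) :
    ∃ K : SimpleGraph V, K ≤ G ∧ (∀ v, ndeg K v ≤ max (ndeg H v) b) ∧
      (∀ v, min (ndeg H v) a ≤ ndeg K v) ∧ ndeg H v0 < ndeg K v0 := by
  obtain ⟨p, hp, hend⟩ := Nat.find_spec h
  have hmin := fun m (hm : m < Nat.find h) => Nat.find_min h hm
  generalize Nat.find h = k at hp hend hmin
  have hpre : ∀ j < k, ¬ GoodEnd H a b (p j) j := fun j hj hg =>
    hmin j hj ⟨p, ⟨hp.1, fun i hi => hp.2 i (by omega)⟩, hg⟩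
  have hpar : ∀ i j, i < k → j < k → i % 2 ≠ j % 2 → p i ≠ p j := by
    intro i j hi hj hij he
    have h1 := hpre i hi
    have h2 := hpre j hj
    rw [he] at h1
    unfold GoodEnd at h1 h2
    omega
  have hd : ∀ i j, i < j → j < k → s(p i, p (i + 1)) ≠ s(p j, p (j + 1)) := by
    intro i j hij hj he
    have hi := hp.2 i (by omega)
    have hj' := hp.2 j hj
    have hpp : i % 2 = j % 2 := by
      have : H.Adj (p i) (p (i + 1)) ↔ H.Adj (p j) (p (j + 1)) := by
        rw [← SimpleGraph.mem_edgeSet, ← SimpleGraph.mem_edgeSet, he]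
      rw [hi.2, hj'.2] at this
      omega
    rw [Sym2.eq_iff] at he
    rcases he with ⟨h1, _⟩ | ⟨_, h2⟩
    · refine hmin (k - (j - i)) (by omega)
        ⟨fun t => if t ≤ i then p t else p (t + (j - i)), ⟨by simp [hp.1], ?_⟩, ?_⟩
      · intro t ht
        rcases lt_trichotomy t i with c | c | c
        · have := hp.2 t (by omega)
          simpa [show t ≤ i by omega, show t + 1 ≤ i by omega] using this
        · subst c
          have e : t + 1 + (j - t) = j + 1 := by omega
          simp only [le_refl, if_true, show ¬ (t + 1 ≤ t) by omega, if_false, e, h1]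
          rw [hpp]; exact hj'
        · have := hp.2 (t + (j - i)) (by omega)
          have e : t + 1 + (j - i) = t + (j - i) + 1 := by omega
          simp only [show ¬ (t ≤ i) by omega, show ¬ (t + 1 ≤ i) by omega, if_false, e]
          rw [show t % 2 = (t + (j - i)) % 2 by omega]
          exact this
      · have e : k - (j - i) + (j - i) = k := by omega
        simp only [show ¬ (k - (j - i) ≤ i) by omega, if_false, e]
        unfold GoodEnd at hend ⊢
        rwa [show (k - (j - i)) % 2 = k % 2 by omega]
    · exact hpar (i + 1) j (by omega) hj (by omega) h2
  obtain ⟨K, hK, -, hKd⟩ := swap_trail G H hHG v0 p k hp hd k le_rfl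
  refine ⟨K, hK, ?_, ?_, ?_⟩
  · intro v
    have := hKd v
    unfold GoodEnd at hend
    by_cases c1 : v = v0 <;> by_cases c2 : v = p k <;> by_cases c3 : k % 2 = 1 <;>
      simp only [c1, c2, c3, if_true, if_false] at this hend ⊢ <;> grind
  · intro v
    have := hKd v
    unfold GoodEnd at hend
    by_cases c1 : v = v0 <;> by_cases c2 : v = p k <;> by_cases c3 : k % 2 = 1 <;>
      simp only [c1, c2, c3, if_true, if_false] at this hend ⊢ <;> grind
  · have := hKd v0
    unfold GoodEnd at hend
    by_cases c2 : v0 = p k <;> by_cases c3 : k % 2 = 1 <;>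
      simp only [c2, c3, if_true, if_false] at this hend ⊢ <;> grind

open Classical in
/-- Sufficiency in the `[a,b]`-factor theorem. -/
lemma factor_criterion {V : Type*} [Fintype V] (G : SimpleGraph V) (a b : ℕ) (hab : a < b)
    (hno : ¬ ∃ H : SimpleGraph V, H ≤ G ∧ ∀ v, a ≤ ndeg H v ∧ ndeg H v ≤ b) :
    ∃ S T : Finset V, Disjoint S T ∧
      (b : ℤ) * S.card + ∑ x ∈ T, ((∑ w ∈ Sᶜ, if G.Adj x w then (1 : ℤ) else 0) - a) ≤ -1 := by
  obtain ⟨H, hHm, hHmin⟩ := Finset.exists_min_image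
    (Finset.univ.filter fun H : SimpleGraph V => H ≤ G ∧ ∀ v, ndeg H v ≤ b)
    (fun H => ∑ v, (a - ndeg H v)) ⟨⊥, Finset.mem_filter.mpr
      ⟨Finset.mem_univ _, bot_le, fun v => by simp [ndeg, SimpleGraph.neighborSet]⟩⟩
  simp only [Finset.mem_filter, Finset.mem_univ, true_and] at hHm hHmin
  obtain ⟨hHG, hHb⟩ := hHm
  obtain ⟨v0, hv0⟩ : ∃ v0, ndeg H v0 < a := by
    by_contra! hc
    exact hno ⟨H, hHG, fun v => ⟨hc v, hHb v⟩⟩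
  have hna : ¬ ∃ k p, AltW G H v0 p k ∧ GoodEnd H a b (p k) k := by
    intro h
    obtain ⟨K, hKG, hK1, hK2, hK3⟩ := augment G H hHG a b hab v0 hv0 h
    have := hHmin K ⟨hKG, fun v => by have := hK1 v; have := hHb v; omega⟩
    refine absurd this (not_le.mpr ?_)
    refine Finset.sum_lt_sum (fun v _ => ?_) ⟨v0, Finset.mem_univ _, by omega⟩
    have := hK2 v
    omega
  let S : Finset V := Finset.univ.filter fun y => ∃ k p, AltW G H v0 p k ∧ p k = y ∧ k % 2 = 1
  let T : Finset V := Finset.univ.filter fun y => ∃ k p, AltW G H v0 p k ∧ p k = y ∧ k % 2 = 0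
  have hS : ∀ y ∈ S, b ≤ ndeg H y := by
    intro y hy
    simp only [S, Finset.mem_filter, Finset.mem_univ, true_and] at hy
    obtain ⟨k, p, hp, rfl, hk⟩ := hy
    by_contra hc
    exact hna ⟨k, p, hp, Or.inl ⟨hk, by omega⟩⟩
  have hT : ∀ y ∈ T, ndeg H y ≤ a := by
    intro y hy
    simp only [T, Finset.mem_filter, Finset.mem_univ, true_and] at hy
    obtain ⟨k, p, hp, rfl, hk⟩ := hy
    by_contra hc
    exact hna ⟨k, p, hp, Or.inr ⟨hk, by omega⟩⟩
  have hv0T : v0 ∈ T := by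
    simp only [T, Finset.mem_filter, Finset.mem_univ, true_and]
    exact ⟨0, fun _ => v0, ⟨rfl, by simp⟩, rfl, rfl⟩
  have hext : ∀ k p w, AltW G H v0 p k → G.Adj (p k) w → (H.Adj (p k) w ↔ k % 2 = 1) →
      ∃ q, AltW G H v0 q (k + 1) ∧ q (k + 1) = w := by
    intro k p w hp hG hH
    refine ⟨fun t => if t ≤ k then p t else w, ⟨by simp [hp.1], ?_⟩, by simp⟩
    intro i hi
    rcases Nat.lt_or_ge i k with c | c
    · simpa [show i ≤ k by omega, show i + 1 ≤ k by omega] using hp.2 i c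
    · have : i = k := by omega
      subst this
      simpa using ⟨hG, hH⟩
  have hTS : ∀ x ∈ T, ∀ w, G.Adj x w → ¬ H.Adj x w → w ∈ S := by
    intro x hx w hG hH
    simp only [T, S, Finset.mem_filter, Finset.mem_univ, true_and] at hx ⊢
    obtain ⟨k, p, hp, rfl, hk⟩ := hx
    obtain ⟨q, hq, hq'⟩ := hext k p w hp hG (by simp [hH, hk])
    exact ⟨k + 1, q, hq, hq', by omega⟩
  have hST : ∀ x ∈ S, ∀ w, H.Adj x w → w ∈ T := by
    intro x hx w hH
    simp only [T, S, Finset.mem_filter, Finset.mem_univ, true_and] at hx ⊢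
    obtain ⟨k, p, hp, rfl, hk⟩ := hx
    obtain ⟨q, hq, hq'⟩ := hext k p w hp (hHG hH) (by simp [hH, hk])
    exact ⟨k + 1, q, hq, hq', by omega⟩
  refine ⟨S, T, ?_, ?_⟩
  · rw [Finset.disjoint_left]
    intro x h1 h2
    have := hS x h1
    have := hT x h2
    omega
  · have e1 : (b : ℤ) * S.card ≤ ∑ y ∈ S, ∑ x ∈ T, if H.Adj y x then (1 : ℤ) else 0 := by
      rw [mul_comm, ← nsmul_eq_mul, ← Finset.sum_const]
      refine Finset.sum_le_sum fun y hy => ?_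
      have h1 : (b : ℤ) ≤ ndeg H y := by exact_mod_cast hS y hy
      refine h1.trans (le_of_eq ?_)
      rw [ndeg_eq_sum]
      symm
      refine Finset.sum_subset (Finset.subset_univ _) fun w _ hw => ?_
      rw [if_neg]
      exact fun h => hw (hST y hy w h)
    have e2 : ∀ x ∈ T, (∑ w ∈ Sᶜ, if G.Adj x w then (1 : ℤ) else 0) =
        ndeg H x - ∑ w ∈ S, if H.Adj x w then (1 : ℤ) else 0 := by
      intro x hx
      rw [ndeg_eq_sum, ← Finset.sum_add_sum_compl S, add_sub_cancel_left]
      refine Finset.sum_congr rfl fun w hw => ?_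
      have : G.Adj x w ↔ H.Adj x w := by
        refine ⟨fun h => ?_, fun h => hHG h⟩
        by_contra hc
        exact (Finset.mem_compl.mp hw) (hTS x hx w h hc)
      simp [this]
    have e3 : ∑ x ∈ T, ((∑ w ∈ Sᶜ, if G.Adj x w then (1 : ℤ) else 0) - a) =
        ∑ x ∈ T, ((ndeg H x : ℤ) - a) - ∑ x ∈ T, ∑ w ∈ S, if H.Adj x w then (1 : ℤ) else 0 := by
      rw [← Finset.sum_sub_distrib]
      refine Finset.sum_congr rfl fun x hx => ?_
      rw [e2 x hx]; ring
    have e4 : ∑ x ∈ T, ((ndeg H x : ℤ) - a) ≤ -1 := by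
      rw [← Finset.sum_erase_add _ _ hv0T]
      have : ∑ x ∈ T.erase v0, ((ndeg H x : ℤ) - a) ≤ 0 :=
        Finset.sum_nonpos fun x hx => by
          have := hT x (Finset.mem_of_mem_erase hx)
          omega
      omega
    rw [e3, Finset.sum_comm (s := T)]
    simp only [H.adj_comm] at e1 ⊢
    have e5 : (∑ y ∈ S, ∑ x ∈ T, if H.Adj x y then (1 : ℤ) else 0) =
      ∑ y ∈ S, ∑ x ∈ T, if H.Adj y x then (1 : ℤ) else 0 := by
      simp only [fun x y => H.adj_comm x y]
    linarith

lemma arith_final (a b n s t p h1 h2 : ℤ) (ha : 1 ≤ a) (hab : a < b)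
    (hn : (a + b) ^ 2 - a ≤ n * b) (h10 : 0 ≤ h1) (h12 : h1 ≤ h2) (h2a : h2 < a)
    (hp : p ≤ h1 + 1) (hst : s + t ≤ n)
    (hd : a * n ≤ (a + b) * (s + h2))
    (hs : b * s + (h1 - a) * p + (h2 - a) * (t - p) ≤ -1) : False := by
  have g1 : (a + b - h2) * s + (h1 - h2) * (h1 + 1) - (a - h2) * n ≤ -1 := by
    nlinarith [mul_nonneg (sub_nonneg.2 h12) (sub_nonneg.2 hp),
      mul_nonneg (sub_nonneg.2 h2a.le) (sub_nonneg.2 hst)]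
  -- multiply by a + b
  have g2 : (a + b - h2) * (a * n - (a + b) * h2) ≤ (a + b - h2) * ((a + b) * s) :=
    mul_le_mul_of_nonneg_left (by linarith) (by linarith)
  have g3 : h2 * ((a + b) ^ 2 - a) ≤ h2 * (n * b) :=
    mul_le_mul_of_nonneg_left hn (by linarith)
  have g4 : (a + b) * ((a + b - h2) * s + (h1 - h2) * (h1 + 1) - (a - h2) * n) ≤ (a + b) * (-1) :=
    mul_le_mul_of_nonneg_left g1 (by linarith)
  have g5 : (a + b) * (h2 ^ 2 + (h1 - h2) * (h1 + 1) + 1) ≤ h2 * a := by nlinarith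
  have g6 : h2 ≤ h2 ^ 2 + (h1 - h2) * (h1 + 1) + 1 := by
    nlinarith [sq_nonneg (h1 - (h2 - 1)), sq_nonneg h1, sq_nonneg (h2 - 1)]
  have g7 : (a + b) * h2 ≤ h2 * a := (mul_le_mul_of_nonneg_left g6 (by linarith)).trans g5
  have g8 : h2 = 0 := by
    by_contra hc
    have : 0 < h2 := by omega
    nlinarith
  have g9 : h1 = 0 := by omega
  subst g8 g9
  nlinarith

/-- Let `1 ≤ a < b` and `G` a graph of order `n ≥ 2a + b + (a²-a)/b` with minimum degree at
least `a`. If `max{d_G(u), d_G(w)} ≥ an/(a+b)` for every pair of nonadjacent vertices `u, w`,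
then `G` contains an `[a,b]`-factor. -/
theorem ab_factor_of_degree_condition
    {V : Type*} [Fintype V] (G : SimpleGraph V) (n a b : ℕ)
    (ha : 1 ≤ a) (hab : a < b) (hcard : Fintype.card V = n)
    (hδ : ∀ v, a ≤ ndeg G v)
    (hn : 2 * a + b + ((a : ℚ) ^ 2 - a) / b ≤ (n : ℚ))
    (hdeg : ∀ u w : V, u ≠ w → ¬ G.Adj u w →
      (a * n : ℚ) / (a + b) ≤ (max (ndeg G u) (ndeg G w) : ℚ)) :
    ∃ H : SimpleGraph V, H ≤ G ∧ ∀ v, a ≤ ndeg H v ∧ ndeg H v ≤ b := by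
  classical
  by_contra hno
  obtain ⟨S, T0, hdis0, hsum0⟩ := factor_criterion G a b hab hno
  set e : V → ℤ := fun x => ∑ w ∈ Sᶜ, if G.Adj x w then (1 : ℤ) else 0 with he
  let T := T0.filter fun x => e x < a
  have hdis : Disjoint S T := Finset.disjoint_of_subset_right (Finset.filter_subset _ _) hdis0
  have hTa : ∀ x ∈ T, e x < a := fun x hx => (Finset.mem_filter.mp hx).2
  have hsum : (b : ℤ) * S.card + ∑ x ∈ T, (e x - a) ≤ -1 := by
    refine le_trans ?_ hsum0
    have : ∑ x ∈ T, (e x - a) ≤ ∑ x ∈ T0, (e x - a) := by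
      rw [← Finset.sum_filter_add_sum_filter_not T0 (fun x => e x < a)]
      have : 0 ≤ ∑ x ∈ T0.filter (fun x => ¬ e x < a), (e x - a) :=
        Finset.sum_nonneg fun x hx => by
          have := (Finset.mem_filter.mp hx).2
          omega
      simp only [T]
      linarith
    have h2 : ∑ x ∈ T0, (e x - a) =
      ∑ x ∈ T0, ((∑ w ∈ Sᶜ, if G.Adj x w then (1 : ℤ) else 0) - a) := rfl
    linarith
  have he0 : ∀ x, 0 ≤ e x := fun x => Finset.sum_nonneg fun w _ => by split_ifs <;> norm_num
  have hde : ∀ x, (ndeg G x : ℤ) ≤ S.card + e x := by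
    intro x
    rw [ndeg_eq_sum, ← Finset.sum_add_sum_compl S]
    have : (∑ w ∈ S, if G.Adj x w then (1 : ℤ) else 0) ≤ ∑ w ∈ S, (1 : ℤ) :=
      Finset.sum_le_sum fun w _ => by split_ifs <;> norm_num
    simp only [Finset.sum_const, nsmul_eq_mul, mul_one] at this
    simp only [he]
    linarith
  have hTne : T.Nonempty := by
    rw [Finset.nonempty_iff_ne_empty]
    intro h
    rw [h] at hsum
    simp at hsum
    have : (0 : ℤ) ≤ b * S.card := by positivity
    omega
  obtain ⟨x1, hx1, hx1m⟩ := Finset.exists_min_image T e hTne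
  let P := T.filter fun x => x = x1 ∨ G.Adj x1 x
  have hP : (P.card : ℤ) ≤ e x1 + 1 := by
    have h1 : P ⊆ insert x1 (Sᶜ.filter fun w => G.Adj x1 w) := by
      intro x hx
      simp only [P, Finset.mem_filter] at hx
      simp only [Finset.mem_insert, Finset.mem_filter, Finset.mem_compl]
      rcases hx.2 with h | h
      · exact Or.inl h
      · exact Or.inr ⟨fun h' => Finset.disjoint_left.mp hdis h' hx.1, h⟩
    have h2 := (Finset.card_le_card h1).trans (Finset.card_insert_le _ _)
    have h3 : e x1 = ((Sᶜ.filter fun w => G.Adj x1 w).card : ℤ) := by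
      simp only [he, Finset.sum_boole]
    rw [h3]
    exact_mod_cast h2
  have hx1a := hTa x1 hx1
  have hd1 := hde x1
  have hδ1 : (a : ℤ) ≤ ndeg G x1 := by exact_mod_cast hδ x1
  have hPlow : (e x1 - a) * P.card ≤ ∑ x ∈ P, (e x - a) := by
    rw [mul_comm, ← nsmul_eq_mul, ← Finset.sum_const]
    refine Finset.sum_le_sum fun y hy => ?_
    have := hx1m y (Finset.mem_filter.mp hy).1
    linarith
  have habZ : (a : ℤ) < b := by exact_mod_cast hab
  have haZ : (1 : ℤ) ≤ a := by exact_mod_cast ha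
  have hsplit := Finset.sum_filter_add_sum_filter_not T (fun x => x = x1 ∨ G.Adj x1 x)
    (fun x => e x - a)
  have hcs := Finset.card_filter_add_card_filter_not (s := T) (fun x => x = x1 ∨ G.Adj x1 x)
  let Q := T.filter fun x => ¬ (x = x1 ∨ G.Adj x1 x)
  change ∑ x ∈ P, (e x - a) + ∑ x ∈ Q, (e x - a) = _ at hsplit
  change P.card + Q.card = T.card at hcs
  rcases Q.eq_empty_or_nonempty with hQ | hQ
  · rw [hQ, Finset.sum_empty] at hsplit
    have k1 : (b : ℤ) * S.card + (e x1 - a) * P.card ≤ -1 := by linarith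
    have k2 := mul_nonneg (sub_nonneg.2 hx1a.le) (sub_nonneg.2 hP)
    have k3 : (b : ℤ) * (a - e x1) ≤ b * S.card :=
      mul_le_mul_of_nonneg_left (by linarith) (by positivity)
    nlinarith
  · obtain ⟨x2, hx2, hx2m⟩ := Finset.exists_min_image Q e hQ
    obtain ⟨hx2T, hx2n⟩ := Finset.mem_filter.mp hx2
    push Not at hx2n
    have hQlow : (e x2 - a) * Q.card ≤ ∑ x ∈ Q, (e x - a) := by
      rw [mul_comm, ← nsmul_eq_mul, ← Finset.sum_const]
      refine Finset.sum_le_sum fun y hy => ?_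
      have := hx2m y hy
      linarith
    have hd2 := hde x2
    have h12 := hx1m x2 hx2T
    have hmax := hdeg x1 x2 hx2n.1.symm hx2n.2
    have hmZ : (a : ℤ) * n ≤ (a + b) * (S.card + e x2) := by
      have q1 : (ndeg G x1 : ℚ) ≤ ((S.card + e x2 : ℤ) : ℚ) := by
        have : (ndeg G x1 : ℤ) ≤ S.card + e x2 := by linarith
        exact_mod_cast this
      have q2 : (ndeg G x2 : ℚ) ≤ ((S.card + e x2 : ℤ) : ℚ) := by exact_mod_cast hd2
      have q3 := hmax.trans (max_le q1 q2)
      have hpos : (0 : ℚ) < a + b := by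
        have : (1 : ℚ) ≤ a := by exact_mod_cast ha
        positivity
      rw [div_le_iff₀ hpos, mul_comm _ ((a : ℚ) + b)] at q3
      exact_mod_cast q3
    have hnZ : ((a : ℤ) + b) ^ 2 - a ≤ n * b := by
      have hb : (0 : ℚ) < b := by
        have : 0 < b := by omega
        exact_mod_cast this
      have q := mul_le_mul_of_nonneg_right hn hb.le
      rw [add_mul, div_mul_cancel₀ _ hb.ne'] at q
      have q' : ((a : ℚ) + b) ^ 2 - a ≤ n * b := by nlinarith
      exact_mod_cast q'
    have hst : (S.card : ℤ) + T.card ≤ n := by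
      rw [← hcard]
      have := Finset.card_le_univ (S ∪ T)
      rw [Finset.card_union_of_disjoint hdis] at this
      exact_mod_cast this
    refine arith_final a b n S.card T.card P.card (e x1) (e x2) haZ habZ hnZ (he0 _) h12
      (hTa x2 hx2T) hP hst hmZ ?_
    have : (T.card : ℤ) - P.card = Q.card := by
      rw [← hcs]; push_cast; ring
    rw [this]
    linarith
end

section
/- Let k ≥ 3 be an integer and let G be a connected graph of order n ≥ 4k−3 with minimum degree δ(G) ≥ k, where k·n is even. If max{d_G(u), d_G(w)} ≥ n/2 for every pair of nonadjacent vertices u and w of G, then G contains a k-factor. -/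
open SimpleGraph Matrix

universe u

/-- labelled Tutte violator -/
def LabViol {W : Type u} [Fintype W] (G : SimpleGraph W) (ι : Type u) (U : Finset W) : Prop :=
  ∃ (c : W → ι) (I : Finset ι), (∀ x y, G.Adj x y → x ∉ U → y ∉ U → c x = c y) ∧
    (∀ i ∈ I, Odd (Set.ncard {w | w ∉ U ∧ c w = i})) ∧ U.card < I.card

theorem exists_labViol {W : Type u} [Fintype W] (G : SimpleGraph W)
    (h : ¬ ∃ M : G.Subgraph, M.IsPerfectMatching) :
    ∃ (ι : Type u) (U : Finset W), LabViol G ι U := by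
  classical
  rw [SimpleGraph.tutte] at h
  push Not at h
  obtain ⟨u, hu⟩ := h
  unfold SimpleGraph.IsTutteViolator at hu
  set K := ((⊤ : G.Subgraph).deleteVerts u) with hK
  have hv : ∀ w, w ∉ u → w ∈ K.verts := by
    intro w hw; simp [hK, hw]
  refine ⟨Option K.coe.ConnectedComponent, u.toFinset,
    fun w => if hw : w ∉ u then some (K.coe.connectedComponentMk ⟨w, hv w hw⟩) else none,
    (K.coe.oddComponents.toFinite.toFinset).map Function.Embedding.some, ?_, ?_, ?_⟩
  · intro x y hxy hx hy
    have hx' : x ∉ u := by simpa using hx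
    have hy' : y ∉ u := by simpa using hy
    simp only [hx', hy', not_false_eq_true, dif_pos]
    congr 1
    apply SimpleGraph.ConnectedComponent.sound
    apply SimpleGraph.Adj.reachable
    simp [hK, hx', hy', hxy]
  · intro i hi
    simp only [Finset.mem_map, Set.Finite.mem_toFinset, Function.Embedding.some_apply] at hi
    obtain ⟨C, hC, rfl⟩ := hi
    have hC' : Odd C.supp.ncard := hC
    convert hC' using 1
    rw [← Set.ncard_image_of_injective C.supp Subtype.val_injective]
    congr 1
    ext w
    simp only [Set.mem_ofPred_eq, Set.mem_image]
    constructor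
    · rintro ⟨h1, h2⟩
      have h1' : w ∉ u := by simpa using h1
      simp only [h1', not_false_eq_true, dif_pos, Option.some.injEq] at h2
      exact ⟨⟨w, hv w h1'⟩, h2, rfl⟩
    · rintro ⟨⟨w', hw'⟩, h1, rfl⟩
      have h1' : w' ∉ u := by
        simp [hK] at hw'; exact hw'
      refine ⟨by simpa using h1', ?_⟩
      simp only [h1', not_false_eq_true, dif_pos, Option.some.injEq]
      exact h1
  · rw [Finset.card_map, ← Set.ncard_eq_toFinset_card, ← Set.ncard_eq_toFinset_card']
    exact hu

theorem labViol_remove {W : Type u} [Fintype W] (G : SimpleGraph W) {ι : Type u} [DecidableEq W]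
    (U : Finset W) (c : W → ι) (I : Finset ι)
    (hc : ∀ x y, G.Adj x y → x ∉ U → y ∉ U → c x = c y)
    (hI : ∀ i ∈ I, Odd (Set.ncard {w | w ∉ U ∧ c w = i})) (hlt : U.card < I.card)
    (x : W) (hx : x ∈ U) (a b : ι) (hab : ∀ y, y ∉ U → G.Adj x y → c y = a ∨ c y = b) :
    LabViol G ι (U.erase x) := by
  classical
  have hUx : (U.erase x).card + 1 = U.card := Finset.card_erase_add_one hx
  have hfib : ∀ i, i ≠ a → i ≠ b →
      {w | w ∉ U.erase x ∧ (if w = x ∨ c w = b then a else c w) = i} = {w | w ∉ U ∧ c w = i} := by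
    intro i hia hib
    ext w
    simp only [Set.mem_ofPred_eq, Finset.mem_erase]
    by_cases h1 : w = x
    · subst h1; simp [hx, hia.symm]
    · by_cases h2 : c w = b
      · simp [h1, h2, hia.symm, hib.symm]
      · simp [h1, h2]
  refine ⟨fun w => if w = x ∨ c w = b then a else c w,
    if a ∈ I ∧ b ∈ I ∧ a ≠ b then I.erase b else (I.erase a).erase b, ?_, ?_, ?_⟩
  · intro y z hyz hy hz
    simp only [Finset.mem_erase, not_and] at hy hz
    by_cases h1 : y = x
    · subst h1
      have hzx : z ≠ y := hyz.ne'
      have := hab z (hz hzx) hyz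
      rcases this with h | h <;> simp [h]
    · by_cases h2 : z = x
      · subst h2
        have := hab y (hy h1) hyz.symm
        rcases this with h | h <;> simp [h]
      · simp [h1, h2, hc y z hyz (hy h1) (hz h2)]
  · intro i hi
    by_cases hcase : a ∈ I ∧ b ∈ I ∧ a ≠ b
    · rw [if_pos hcase] at hi
      obtain ⟨ha, hb, hne⟩ := hcase
      by_cases hia : i = a
      · subst hia
        have : {w | w ∉ U.erase x ∧ (if w = x ∨ c w = b then i else c w) = i} =
          insert x ({w | w ∉ U ∧ c w = i} ∪ {w | w ∉ U ∧ c w = b}) := by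
          ext w
          simp only [Set.mem_ofPred_eq, Finset.mem_erase, Set.mem_insert_iff, Set.mem_union]
          by_cases h1 : w = x
          · simp [h1]
          · by_cases h2 : c w = b
            · simp only [h1, h2]; tauto
            · simp [h1, h2]
        rw [this, Set.ncard_insert_of_notMem (by simp [hx]), Set.ncard_union_eq]
        · have h1 := hI _ ha
          have h2 := hI _ hb
          exact (h1.add_odd h2).add_one
        · rw [Set.disjoint_left]
          rintro w ⟨_, h1⟩ ⟨_, h2⟩
          exact hne (h1.symm.trans h2)
      · rw [hfib i hia (Finset.ne_of_mem_erase hi)]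
        exact hI i (Finset.mem_of_mem_erase hi)
    · rw [if_neg hcase] at hi
      simp only [Finset.mem_erase] at hi
      rw [hfib i hi.2.1 hi.1]
      exact hI i hi.2.2
  · split_ifs with hcase
    · rw [Finset.card_erase_of_mem hcase.2.1]; omega
    · have h1 := Finset.card_le_card (Finset.erase_subset a I)
      by_cases ha : a ∈ I
      · have h2 : b ∉ I.erase a := by
          simp only [Finset.mem_erase]; tauto
        rw [Finset.erase_eq_of_notMem h2, Finset.card_erase_of_mem ha]; omega
      · rw [Finset.erase_eq_of_notMem ha]
        have := Finset.pred_card_le_card_erase (s := I) (a := b)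
        omega

theorem exists_min_labViol {W : Type u} [Fintype W] (G : SimpleGraph W)
    (hW : Even (Fintype.card W))
    (h : ¬ ∃ M : G.Subgraph, M.IsPerfectMatching) :
    ∃ (ι : Type u) (U : Finset W) (c : W → ι) (I : Finset ι),
    (∀ x y, G.Adj x y → x ∉ U → y ∉ U → c x = c y) ∧
    (∀ i ∈ I, Odd (Set.ncard {w | w ∉ U ∧ c w = i})) ∧ U.card + 2 ≤ I.card ∧
    (∀ x ∈ U, ∀ a b, ∃ y, y ∉ U ∧ G.Adj x y ∧ c y ≠ a ∧ c y ≠ b) := by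
  classical
  obtain ⟨ι, U0, h0⟩ := exists_labViol G h
  obtain ⟨U, hU, hmin⟩ := Set.exists_min_image {U | LabViol G ι U} Finset.card (Set.toFinite _) ⟨U0, h0⟩
  obtain ⟨c, I, hc, hI, hlt⟩ := hU
  have hfib : ∀ i, Set.ncard {w | w ∉ U ∧ c w = i} = (Uᶜ.filter (fun w => c w = i)).card := by
    intro i
    rw [← Set.ncard_coe_finset]; congr 1; ext w; simp
  refine ⟨ι, U, c, (Uᶜ.image c).filter (fun i => Odd (Uᶜ.filter (fun w => c w = i)).card), hc, ?_, ?_, ?_⟩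
  · intro i hi
    rw [hfib]; exact (Finset.mem_filter.1 hi).2
  · have hsub : I ⊆ (Uᶜ.image c).filter (fun i => Odd (Uᶜ.filter (fun w => c w = i)).card) := by
      intro i hi
      have h1 := hI i hi
      rw [hfib] at h1
      refine Finset.mem_filter.2 ⟨?_, h1⟩
      have : (Uᶜ.filter (fun w => c w = i)).Nonempty := by
        rw [← Finset.card_pos]; exact h1.pos
      obtain ⟨w, hw⟩ := this
      rw [Finset.mem_filter] at hw
      exact Finset.mem_image.2 ⟨w, hw.1, hw.2⟩
    have h1 := Finset.card_le_card hsub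
    have h2 := Finset.card_eq_sum_card_image c Uᶜ
    have h3 := Finset.odd_sum_iff_odd_card_odd (s := Uᶜ.image c) (fun i => (Uᶜ.filter (fun w => c w = i)).card)
    rw [← h2] at h3
    have h4 := Finset.card_compl_add_card U
    generalize ((Uᶜ.image c).filter (fun i => Odd (Uᶜ.filter (fun w => c w = i)).card)).card = N at *
    rw [Nat.odd_iff, Nat.odd_iff] at h3
    rw [Nat.even_iff] at hW
    omega
  · intro x hx a b
    by_contra hcon
    push Not at hcon
    have := labViol_remove G U c I hc hI hlt x hx a b (by
      intro y hy hxy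
      by_contra h
      push Not at h
      exact h.2 (hcon y hy hxy h.1))
    have h2 := hmin _ this
    have := Finset.card_erase_lt_of_mem hx
    omega


/-- Adjacency of the gadget graph. -/
def gadgetAdj {V : Type u} (G : SimpleGraph V) (k : ℕ) :
    (V × Fin k) ⊕ G.Dart → (V × Fin k) ⊕ G.Dart → Prop
  | Sum.inl p, Sum.inr d => d.fst = p.1
  | Sum.inr d, Sum.inl p => d.fst = p.1
  | Sum.inr d, Sum.inr d' => d' = d.symm
  | Sum.inl _, Sum.inl _ => False

/-- The gadget graph whose perfect matchings correspond to `k`-factors. -/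
def gadget {V : Type u} (G : SimpleGraph V) (k : ℕ) : SimpleGraph ((V × Fin k) ⊕ G.Dart) where
  Adj := gadgetAdj G k
  symm := ⟨by
    rintro (p | d) (p' | d') h
    · exact h
    · exact h
    · exact h
    · change d = d'.symm
      have : d' = d.symm := h
      rw [this, Dart.symm_symm]⟩
  loopless := ⟨by
    rintro (p | d) h
    · exact h
    · exact d.symm_ne h.symm⟩

theorem factor_of_matching {V : Type u} [Fintype V] (G : SimpleGraph V) (k : ℕ)
    (M : (gadget G k).Subgraph) (hM : M.IsPerfectMatching) :
    ∃ H : SimpleGraph V, H ≤ G ∧ ∀ v, (H.neighborSet v).ncard = k := by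
  classical
  rw [Subgraph.isPerfectMatching_iff] at hM
  let H : SimpleGraph V :=
    { Adj := fun v w => ∃ h : G.Adj v w, ¬ M.Adj (Sum.inr ⟨(v, w), h⟩) (Sum.inr ⟨(w, v), h.symm⟩)
      symm := ⟨fun v w ⟨h, h'⟩ => ⟨h.symm, fun h'' => h' h''.symm⟩⟩
      loopless := ⟨fun v ⟨h, _⟩ => G.loopless.irrefl v h⟩ }
  refine ⟨H, fun v w h => h.1, fun v => ?_⟩
  -- each core is matched to a dart
  have hcore : ∀ i : Fin k, ∃ w, ∃ h : G.Adj v w, M.Adj (Sum.inl (v, i)) (Sum.inr ⟨(v, w), h⟩) := by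
    intro i
    obtain ⟨y, hy, -⟩ := hM (Sum.inl (v, i))
    have hadj := M.adj_sub hy
    rcases y with p | ⟨⟨a, b⟩, hd⟩
    · exact hadj.elim
    · have h1 : a = v := hadj
      subst h1
      exact ⟨b, hd, hy⟩
  choose f hf hf' using hcore
  have himg : H.neighborSet v = Set.range f := by
    ext w
    constructor
    · rintro ⟨h, h'⟩
      obtain ⟨y, hy, -⟩ := hM (Sum.inr ⟨(v, w), h⟩)
      have hadj := M.adj_sub hy
      rcases y with ⟨a, i⟩ | d
      · have h1 : v = a := hadj
        subst h1
        refine ⟨i, ?_⟩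
        have h2 := (hM (Sum.inl (v, i))).unique (hf' i) hy.symm
        have h3 := Sum.inr_injective h2
        have h4 := congrArg Dart.toProd h3
        exact (Prod.ext_iff.1 h4).2
      · have h1 : d = _ := hadj
        exfalso
        rw [h1] at hy
        exact h' hy
    · rintro ⟨i, rfl⟩
      refine ⟨hf i, fun h => ?_⟩
      have := (hM _).unique h (hf' i).symm
      exact absurd this (by simp)
  have hinj : Function.Injective f := by
    intro i j hij
    have h1 := (hf' i).symm
    have h2 := (hf' j).symm
    have : (⟨(v, f i), hf i⟩ : G.Dart) = ⟨(v, f j), hf j⟩ := by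
      ext <;> simp [hij]
    rw [this] at h1
    have h3 := (hM _).unique h1 h2
    have h4 := Sum.inl_injective h3
    exact (Prod.ext_iff.1 h4).2
  rw [himg, ← Set.image_univ, Set.ncard_image_of_injective _ hinj, Set.ncard_univ, Nat.card_fin]

open Classical in
theorem dart_card {V : Type u} [Fintype V] (G : SimpleGraph V) (p : V → V → Prop) :
    (Finset.univ.filter (fun d : G.Dart => p d.fst d.snd)).card =
      ∑ v, (Finset.univ.filter (fun w => G.Adj v w ∧ p v w)).card := by
  rw [← Finset.card_sigma]
  refine Finset.card_bij (fun d _ => ⟨d.fst, d.snd⟩) ?_ ?_ ?_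
  · intro d hd
    simp only [Finset.mem_filter, Finset.mem_univ, true_and] at hd
    simp [hd, d.adj]
  · intro d _ d' _ h
    simp only [Sigma.mk.injEq, heq_eq_eq] at h
    exact Dart.ext _ _ (Prod.ext h.1 h.2)
  · rintro ⟨v, w⟩ h
    simp only [Finset.mem_sigma, Finset.mem_filter, Finset.mem_univ, true_and] at h
    exact ⟨⟨(v, w), h.1⟩, by simp [h.2], rfl⟩


open Classical in
theorem exists_barrier {V : Type u} [Fintype V] (G : SimpleGraph V) (k : ℕ) (hk : 1 ≤ k)
    (heven : Even (k * Fintype.card V)) (hδ : ∀ v, ∃ w, G.Adj v w)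
    (hno : ¬ ∃ H : SimpleGraph V, H ≤ G ∧ ∀ v, (H.neighborSet v).ncard = k) :
    ∃ (ι : Type u) (S T : Finset V) (c : V → ι) (I : Finset ι), Disjoint S T ∧
      (∀ v w, G.Adj v w → v ∉ S → v ∉ T → w ∉ S → w ∉ T → c v = c w) ∧
      (∀ i ∈ I, Odd (k * (Finset.univ.filter (fun v => v ∉ S ∧ v ∉ T ∧ c v = i)).card +
        ∑ v ∈ Finset.univ.filter (fun v => v ∉ S ∧ v ∉ T ∧ c v = i), (T.filter (G.Adj v)).card)) ∧
      k * S.card + ∑ x ∈ T, (Finset.univ.filter (fun w => w ∉ S ∧ G.Adj x w)).card + 2 ≤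
        k * T.card + I.card := by
  have hW : Even (Fintype.card ((V × Fin k) ⊕ G.Dart)) := by
    rw [Fintype.card_sum, Fintype.card_prod, Fintype.card_fin, mul_comm, G.dart_card_eq_twice_card_edges]
    exact heven.add (even_two_mul _)
  have hnoM : ¬ ∃ M : (gadget G k).Subgraph, M.IsPerfectMatching := by
    rintro ⟨M, hM⟩
    exact hno (factor_of_matching G k M hM)
  obtain ⟨ι, U, c, I, hc, hI, hcard, hmin⟩ := exists_min_labViol (gadget G k) hW hnoM
  let o : Fin k := ⟨0, hk⟩
  have adj_cd : ∀ (v : V) (i : Fin k) (d : G.Dart), d.fst = v →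
      (gadget G k).Adj (Sum.inl (v, i)) (Sum.inr d) := fun v i d h => h
  have adj_dd : ∀ (d : G.Dart), (gadget G k).Adj (Sum.inr d) (Sum.inr d.symm) := fun d => rfl
  -- F1
  have F1 : ∀ d : G.Dart, Sum.inr d ∈ U → ∀ d' : G.Dart, d'.fst = d.fst → Sum.inr d' ∈ U := by
    intro d hd d' hd'
    by_contra hcon
    obtain ⟨y, hy, hadj, ha, hb⟩ := hmin _ hd (c (Sum.inr d')) (c (Sum.inr d.symm))
    rcases y with ⟨v, i⟩ | e
    · have hv : d.fst = v := hadj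
      exact ha (hc _ _ (adj_cd v i d' (hd'.trans hv)) hy hcon)
    · have he : e = d.symm := hadj
      exact hb (by rw [he])
  have F2 : ∀ v i, Sum.inl (v, i) ∈ U → (∀ j, Sum.inl (v, j) ∈ U) ∧
      ∀ d : G.Dart, d.fst = v → Sum.inr d ∉ U := by
    intro v i hvi
    constructor
    · intro j
      by_contra hcon
      obtain ⟨y, hy, hadj, ha, hb⟩ := hmin _ hvi (c (Sum.inl (v, j))) (c (Sum.inl (v, j)))
      rcases y with p | e
      · exact hadj
      · have he : e.fst = v := hadj
        exact ha (hc _ _ (adj_cd v j e he) hcon hy).symm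
    · intro d hd hdU
      obtain ⟨y, hy, hadj, ha, hb⟩ := hmin _ hvi (c (Sum.inr d)) (c (Sum.inr d))
      rcases y with p | e
      · exact hadj
      · have he : e.fst = v := hadj
        exact hy (F1 d hdU e (he.trans hd.symm))
  let S : Finset V := Finset.univ.filter (fun v => Sum.inl (v, o) ∈ U)
  let T : Finset V := Finset.univ.filter (fun v => ∃ d : G.Dart, d.fst = v ∧ Sum.inr d ∈ U)
  have hS : ∀ v i, Sum.inl (v, i) ∈ U ↔ v ∈ S := by
    intro v i
    simp only [S, Finset.mem_filter, Finset.mem_univ, true_and]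
    exact ⟨fun h => (F2 v i h).1 o, fun h => (F2 v o h).1 i⟩
  have hT : ∀ d : G.Dart, Sum.inr d ∈ U ↔ d.fst ∈ T := by
    intro d
    simp only [T, Finset.mem_filter, Finset.mem_univ, true_and]
    exact ⟨fun h => ⟨d, rfl, h⟩, fun ⟨d', h1, h2⟩ => F1 d' h2 d h1.symm⟩
  have hST : Disjoint S T := by
    rw [Finset.disjoint_left]
    intro v hv hvT
    obtain ⟨w, hw⟩ := hδ v
    exact (F2 v o ((hS v o).2 hv)).2 ⟨(v, w), hw⟩ rfl ((hT ⟨(v, w), hw⟩).2 hvT)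
  -- label of cores and darts of free vertices
  have hcoreT : ∀ v i, v ∉ S → v ∉ T → c (Sum.inl (v, i)) = c (Sum.inl (v, o)) := by
    intro v i h1 h2
    obtain ⟨w, hw⟩ := hδ v
    have hd : (Sum.inr ⟨(v, w), hw⟩ : (V × Fin k) ⊕ G.Dart) ∉ U := fun h => h2 ((hT _).1 h)
    have e1 := hc _ _ (adj_cd v i ⟨(v, w), hw⟩ rfl) (fun h => h1 ((hS _ _).1 h)) hd
    have e2 := hc _ _ (adj_cd v o ⟨(v, w), hw⟩ rfl) (fun h => h1 ((hS _ _).1 h)) hd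
    exact e1.trans e2.symm
  have hdart : ∀ d : G.Dart, d.fst ∉ S → d.fst ∉ T → c (Sum.inr d) = c (Sum.inl (d.fst, o)) := by
    intro d h1 h2
    exact (hc _ _ (adj_cd d.fst o d rfl) (fun h => h1 ((hS _ _).1 h)) (fun h => h2 ((hT _).1 h))).symm
  let Iso : Finset ((V × Fin k) ⊕ G.Dart) := Finset.univ.filter (fun x => match x with
    | Sum.inl p => p.1 ∈ T
    | Sum.inr d => d.fst ∈ S ∧ d.snd ∈ T)
  have hIso1 : ∀ p, Sum.inl p ∈ Iso ↔ p.1 ∈ T := by intro p; simp [Iso]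
  have hIso2 : ∀ d, Sum.inr d ∈ Iso ↔ d.fst ∈ S ∧ d.snd ∈ T := by intro p; simp [Iso]
  refine ⟨ι, S, T, fun v => c (Sum.inl (v, o)), I \ Iso.image c, hST, ?_, ?_, ?_⟩
  · intro v w hvw h1 h2 h3 h4
    have e1 := hdart ⟨(v, w), hvw⟩ h1 h2
    have e2 := hdart ⟨(w, v), hvw.symm⟩ h3 h4
    have e3 := hc _ _ (adj_dd ⟨(v, w), hvw⟩) (fun h => h2 ((hT _).1 h)) (fun h => h4 ((hT _).1 h))
    exact e1.symm.trans (e3.trans e2)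
  · intro i hi
    rw [Finset.mem_sdiff] at hi
    have hiso : ∀ x ∈ Iso, c x ≠ i := fun x hx h => hi.2 (h ▸ Finset.mem_image_of_mem c hx)
    have hodd := hI i hi.1
    have hfib : Set.ncard {w | w ∉ U ∧ c w = i} =
        (Finset.univ.filter (fun p : V × Fin k => Sum.inl p ∉ U ∧ c (Sum.inl p) = i)).card +
        (Finset.univ.filter (fun d : G.Dart => Sum.inr d ∉ U ∧ c (Sum.inr d) = i)).card := by
      have : {w | w ∉ U ∧ c w = i} = ((Finset.univ.filter (fun w => w ∉ U ∧ c w = i) : Finset _) : Set _) := by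
        ext; simp
      rw [this, Set.ncard_coe_finset]
      simp only [Finset.card_filter, Fintype.sum_sum_type]
    have hcores : (Finset.univ.filter (fun p : V × Fin k => Sum.inl p ∉ U ∧ c (Sum.inl p) = i)).card =
        k * (Finset.univ.filter (fun v => v ∉ S ∧ v ∉ T ∧ c (Sum.inl (v, o)) = i)).card := by
      have : Finset.univ.filter (fun p : V × Fin k => Sum.inl p ∉ U ∧ c (Sum.inl p) = i) =
          (Finset.univ.filter (fun v => v ∉ S ∧ v ∉ T ∧ c (Sum.inl (v, o)) = i)) ×ˢ Finset.univ := by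
        ext ⟨v, j⟩
        simp only [Finset.mem_filter, Finset.mem_univ, true_and, Finset.mem_product, and_true, hS]
        constructor
        · rintro ⟨h1, h2⟩
          have h3 : v ∉ T := fun h => hiso _ ((hIso1 (v, j)).2 h) h2
          exact ⟨h1, h3, (hcoreT v j h1 h3) ▸ h2⟩
        · rintro ⟨h1, h2, h3⟩
          exact ⟨h1, (hcoreT v j h1 h2).trans h3⟩
      rw [this, Finset.card_product, Finset.card_univ, Fintype.card_fin, mul_comm]
    have hsplit := Finset.card_filter_add_card_filter_not
      (s := Finset.univ.filter (fun d : G.Dart => Sum.inr d ∉ U ∧ c (Sum.inr d) = i))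
      (fun d => d.snd ∈ T)
    have hevn : Even ((Finset.univ.filter (fun d : G.Dart => Sum.inr d ∉ U ∧ c (Sum.inr d) = i)).filter
        (fun d => ¬ d.snd ∈ T)).card := by
      set A := (Finset.univ.filter (fun d : G.Dart => Sum.inr d ∉ U ∧ c (Sum.inr d) = i)).filter
        (fun d => ¬ d.snd ∈ T) with hA
      have hmem : ∀ d, d ∈ A ↔ (d.fst ∉ T ∧ c (Sum.inr d) = i) ∧ d.snd ∉ T := by
        intro d; simp [hA, hT]
      have hsum : ∑ _d ∈ A, (1 : ZMod 2) = 0 := by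
        refine Finset.sum_involution (fun d _ => d.symm) ?_ ?_ ?_ ?_
        · intro d _; decide
        · intro d _ _; exact d.symm_ne
        · intro d hd
          rw [hmem] at hd ⊢
          refine ⟨⟨hd.2, ?_⟩, hd.1.1⟩
          rw [← hd.1.2]
          exact (hc _ _ (adj_dd d) (fun h => hd.1.1 ((hT _).1 h)) (fun h => hd.2 ((hT _).1 h))).symm
        · intro d _; exact d.symm_symm
      rw [Finset.sum_const, nsmul_eq_mul, mul_one] at hsum
      exact (ZMod.natCast_eq_zero_iff_even).1 hsum
    have hTd : ((Finset.univ.filter (fun d : G.Dart => Sum.inr d ∉ U ∧ c (Sum.inr d) = i)).filter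
        (fun d => d.snd ∈ T)).card =
        ∑ v ∈ Finset.univ.filter (fun v => v ∉ S ∧ v ∉ T ∧ c (Sum.inl (v, o)) = i),
          (T.filter (G.Adj v)).card := by
      have : (Finset.univ.filter (fun d : G.Dart => Sum.inr d ∉ U ∧ c (Sum.inr d) = i)).filter
        (fun d => d.snd ∈ T) = Finset.univ.filter (fun d : G.Dart =>
          (fun v w => (v ∉ S ∧ v ∉ T ∧ c (Sum.inl (v, o)) = i) ∧ w ∈ T) d.fst d.snd) := by
        ext d
        simp only [Finset.mem_filter, Finset.mem_univ, true_and, hT]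
        constructor
        · rintro ⟨⟨h1, h2⟩, h3⟩
          have h4 : d.fst ∉ S := fun h => hiso _ ((hIso2 d).2 ⟨h, h3⟩) h2
          exact ⟨⟨h4, h1, (hdart d h4 h1) ▸ h2⟩, h3⟩
        · rintro ⟨⟨h1, h2, h3⟩, h4⟩
          exact ⟨⟨h2, (hdart d h1 h2).trans h3⟩, h4⟩
      rw [this]
      refine Eq.trans (b := ∑ v, (Finset.univ.filter (fun w => G.Adj v w ∧
        ((v ∉ S ∧ v ∉ T ∧ c (Sum.inl (v, o)) = i) ∧ w ∈ T))).card) (by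
          convert dart_card G (fun v w => (v ∉ S ∧ v ∉ T ∧ c (Sum.inl (v, o)) = i) ∧ w ∈ T)) ?_
      rw [Finset.sum_filter]
      refine Finset.sum_congr rfl fun v _ => ?_
      split_ifs with hv
      · congr 1; ext w; simp [hv, and_comm]
      · rw [Finset.card_eq_zero]; ext w; simp only [Finset.mem_filter, Finset.notMem_empty, iff_false]; tauto
    rw [hfib, hcores, ← hsplit, hTd] at hodd
    beta_reduce
    rw [Nat.odd_iff] at hodd ⊢
    rw [Nat.even_iff] at hevn
    omega
  · have hUc : U.card = k * S.card + ∑ x ∈ T, (Finset.univ.filter (fun w => G.Adj x w)).card := by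
      have : U = Finset.univ.filter (fun w => w ∈ U) := by simp
      rw [this, Finset.card_filter, Fintype.sum_sum_type, ← Finset.card_filter, ← Finset.card_filter]
      congr 1
      · have : Finset.univ.filter (fun p : V × Fin k => Sum.inl p ∈ U) = S ×ˢ Finset.univ := by
          ext ⟨v, j⟩; simp [hS]
        rw [this, Finset.card_product, Finset.card_univ, Fintype.card_fin, mul_comm]
      · simp only [hT]
        refine Eq.trans (b := ∑ v, (Finset.univ.filter (fun w => G.Adj v w ∧ v ∈ T)).card)
          (by convert dart_card G (fun v w => v ∈ T)) ?_
        rw [← Finset.sum_filter_add_sum_filter_not _ (fun v => v ∈ T)]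
        rw [Finset.filter_mem_eq_inter, Finset.univ_inter]
        have : ∑ x ∈ Finset.univ.filter (fun x => x ∉ T), (Finset.univ.filter (fun w => G.Adj x w ∧ x ∈ T)).card = 0 := by
          apply Finset.sum_eq_zero
          intro x hx
          rw [Finset.card_eq_zero]; ext w; simp at hx ⊢; tauto
        rw [this, add_zero]
        refine Finset.sum_congr rfl fun x hx => ?_
        congr 1; ext w; simp [hx]
    have hIsoc : Iso.card = k * T.card + ∑ x ∈ T, (Finset.univ.filter (fun w => w ∈ S ∧ G.Adj x w)).card := by
      have : Iso = Finset.univ.filter (fun w => w ∈ Iso) := by simp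
      rw [this, Finset.card_filter, Fintype.sum_sum_type, ← Finset.card_filter, ← Finset.card_filter]
      simp only [hIso1, hIso2]
      congr 1
      · have : Finset.univ.filter (fun p : V × Fin k => p.1 ∈ T) = T ×ˢ Finset.univ := by
          ext ⟨v, j⟩; simp
        rw [this, Finset.card_product, Finset.card_univ, Fintype.card_fin, mul_comm]
      · refine Eq.trans (b := ∑ v, (Finset.univ.filter (fun w => G.Adj v w ∧ v ∈ S ∧ w ∈ T)).card)
          (by convert dart_card G (fun v w => v ∈ S ∧ w ∈ T)) ?_
        have e1 : ∀ v, (Finset.univ.filter (fun w => G.Adj v w ∧ v ∈ S ∧ w ∈ T)).card =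
          ∑ w ∈ T, if (v ∈ S ∧ G.Adj w v) then 1 else 0 := by
          intro v
          rw [← Finset.card_filter]
          congr 1
          ext w; simp [G.adj_comm]; tauto
        rw [Finset.sum_congr rfl (fun v _ => e1 v), Finset.sum_comm]
        simp only [Finset.card_filter]
    have h1 : I.card ≤ (I \ Iso.image c).card + Iso.card := by
      have := Finset.card_le_card_sdiff_add_card (s := I) (t := Iso.image c)
      have h2 := Finset.card_image_le (s := Iso) (f := c)
      omega
    have h2 : ∑ x ∈ T, (Finset.univ.filter (fun w => G.Adj x w)).card =
       ∑ x ∈ T, (Finset.univ.filter (fun w => w ∈ S ∧ G.Adj x w)).card +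
       ∑ x ∈ T, (Finset.univ.filter (fun w => w ∉ S ∧ G.Adj x w)).card := by
      rw [← Finset.sum_add_distrib]
      refine Finset.sum_congr rfl fun x _ => ?_
      rw [← Finset.card_filter_add_card_filter_not (s := Finset.univ.filter (fun w => G.Adj x w)) (fun w => w ∈ S)]
      rw [Finset.filter_filter, Finset.filter_filter]
      simp only [and_comm]
    omega


theorem regimeI (k ν s t h q EL EH : ℤ) (hk : 3 ≤ k) (hν : 2 * k - 1 ≤ ν)
    (hs : 0 ≤ s) (ht : 0 ≤ t) (hh : 0 ≤ h) (hq : 0 ≤ q) (hEL0 : 0 ≤ EL) (hEH0 : 0 ≤ EH)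
    (H1 : t * (t - 1) ≤ EL) (H3 : (ν - s) * h ≤ EH)
    (H4 : k * s + EL + EH + 2 ≤ k * (t + h) + q)
    (H0 : s + t + h + q ≤ 2 * ν) : k ≤ ν - s := by
  by_contra hcon
  push Not at hcon
  by_cases hb : ν - s ≤ 0
  · nlinarith
  · push Not at hb
    obtain ⟨β, rfl⟩ : ∃ β, ν = β + s := ⟨ν - s, by ring⟩
    have e : β + s - s = β := by ring
    rw [e] at *
    -- (k-β) h ≤ (k-β)(2β+s-t-q)
    have h1 : (k - β) * h ≤ (k - β) * (2 * β + s - t - q) :=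
      mul_le_mul_of_nonneg_left (by linarith) (by linarith)
    have h2 : 0 ≤ (k - β - 1) * q := mul_nonneg (by linarith) hq
    have h3 : β * (2 * k - 1 - β) ≤ β * s := mul_le_mul_of_nonneg_left (by linarith) (by linarith)
    nlinarith [sq_nonneg (2 * t - β - 1), sq_nonneg (β - 1)]

/-- lower bounds for `D = k s + EL - k t`. -/
theorem D_bound1 (k s t EL : ℤ) (H2 : t * (k - s) ≤ EL) :
    s * (k - t) ≤ k * s + EL - k * t := by nlinarith

theorem D_bound2 (k s t EL : ℤ) (ht : k + 1 ≤ t) (hk : 3 ≤ k)  (H1 : t * (t - 1) ≤ EL) :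
    k * s ≤ k * s + EL - k * t := by nlinarith

/-- main inequality in the case `s ≥ 1`, `β ≥ k+1`. -/
theorem caseA (k β s t h g D : ℤ) (hk : 3 ≤ k) (hs : 1 ≤ s) (hh : 0 ≤ h)
    (hβ : k + 1 ≤ β)
    (hD1 : s * (k - t) ≤ D) (hD2 : k + 1 ≤ t → k * s ≤ D) (hg : h * (β - k) ≤ g - D)
    (hs1 : t ≤ k → g * (β - 1) ≤ t * (k - t) - k * s + k * h)
    (hs2 : k + 1 ≤ t → g * (β - 1) ≤ - k * s + k * h) : False := by
  have h0 : h ≤ h * (β - k) := by nlinarith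
  have h1 : k * h ≤ (g - D) * (β - 1) := by nlinarith
  have hks : 0 < k * s := by positivity
  rcases le_or_gt t k with htk | htk
  · have := hs1 htk
    have h2 : s * (k - t) * (β - 1) ≤ D * (β - 1) := mul_le_mul_of_nonneg_right hD1 (by linarith)
    have h3 : k ≤ s * (β - 1) := by nlinarith
    have h4 : 0 ≤ (k - t) * (s * (β - 1) - t) := mul_nonneg (by linarith) (by linarith)
    nlinarith
  · have h2 := hs2 (by omega)
    have h3 := hD2 (by omega)
    have h4 : 0 ≤ D * (β - 1) := mul_nonneg (by linarith) (by linarith)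
    nlinarith

/-- the case `s ≥ 1`, `β = k` with a big piece. -/
theorem caseB1 (k s t h g D : ℤ) (hk : 3 ≤ k) (hs : k - 1 ≤ s) (ht : 0 ≤ t)
    (hD1 : s * (k - t) ≤ D) (hD2 : k + 1 ≤ t → k * s ≤ D) (hg : D ≤ g) (hg0 : 0 ≤ g)
    (hsize : g + 2 + t + h ≤ k + s)
    (hs1 : t ≤ k → g * (k - 1) ≤ t * (k - t) - k * s + k * h)
    (hs2 : k + 1 ≤ t → g * (k - 1) ≤ - k * s + k * h) : False := by
  have h0 : k * h ≤ k * (k + s - g - 2 - t) := mul_le_mul_of_nonneg_left (by linarith) (by linarith)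
  rcases le_or_gt t k with htk | htk
  · have h1 := hs1 htk
    have h2 : g * (2 * k - 1) ≤ k * (k - 2) - t ^ 2 := by nlinarith
    rcases eq_or_lt_of_le htk with he | hl
    · subst he; nlinarith
    · have : k - 1 ≤ g := by nlinarith
      nlinarith
  · have h1 := hs2 (by omega)
    nlinarith

/-- the case `s ≥ 1`, `β = k` without a big piece. -/
theorem caseB2 (k s t h g D EL : ℤ) (hk : 3 ≤ k) (hs : k - 1 ≤ s) (ht : 0 ≤ t)
    (hDE : D = k * s + EL - k * t) (hEL : t * (t - 1) ≤ EL)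
    (hD1 : s * (k - t) ≤ D) (hD2 : k + 1 ≤ t → k * s ≤ D) (hg : D ≤ g) (hg0 : 0 ≤ g)
    (hsize : g + 2 + t + h ≤ 2 * k + s)
    (hs1 : t ≤ k → g * (k - 1) ≤ t * (k - t) - k * s + k * h - k)
    (hs2 : k + 1 ≤ t → g * (k - 1) ≤ - k * s + k * h - k) : False := by
  have h0 : k * h ≤ k * (2 * k + s - g - 2 - t) := mul_le_mul_of_nonneg_left (by linarith) (by linarith)
  rcases le_or_gt t k with htk | htk
  · have h1 := hs1 htk
    have h2 : g * (2 * k - 1) ≤ 2 * k ^ 2 - 3 * k - t ^ 2 := by nlinarith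
    rcases eq_or_lt_of_le htk with he | hl
    · subst he
      have h3 : t * (t - 2) ≤ g := by nlinarith
      nlinarith
    · have : k - 1 ≤ g := by nlinarith
      nlinarith
  · have h1 := hs2 (by omega)
    have h3 := hD2 (by omega)
    have h4 : k * (k - 1) ≤ g := by nlinarith
    nlinarith

/-- `s = 0`: no high vertices in `T`. -/
theorem caseC_h (k β t h g : ℤ) (hk : 3 ≤ k) (hβ : 2 * k - 1 ≤ β) (ht : 0 ≤ t) (hh : 0 ≤ h)
    (hg : h * (β - k) ≤ g)
    (hs1 : t ≤ k → g * (β - 1) ≤ t * (k - t) + k * h)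
    (hs2 : k + 1 ≤ t → g * (β - 1) ≤ k * h) : h = 0 := by
  by_contra hne
  have hpos : 1 ≤ h := by omega
  have h1 : 4 * (g * (β - 1)) ≤ k ^ 2 + 4 * k * h := by
    rcases le_or_gt t k with htk | htk
    · nlinarith [hs1 htk, sq_nonneg (2 * t - k)]
    · nlinarith [hs2 (by omega)]
  have h2 : h * (k - 1) ≤ g := by nlinarith
  have h3 : (h * (k - 1)) * (2 * k - 2) ≤ g * (β - 1) :=
    mul_le_mul h2 (by linarith) (by linarith) (by nlinarith)
  have h4 : k ^ 2 < 8 * (k - 1) ^ 2 - 4 * k := by nlinarith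
  have h5 : 1 * (8 * (k - 1) ^ 2 - 4 * k) ≤ h * (8 * (k - 1) ^ 2 - 4 * k) :=
    mul_le_mul_of_nonneg_right hpos (by nlinarith)
  nlinarith

/-- `s = 0`: two high pieces are impossible. -/
theorem caseC_two (k β t g c1 c2 e1 e2 : ℤ) (hk : 3 ≤ k) (hβ : 2 * k - 1 ≤ β) (ht : 0 ≤ t)
    (htk : t ≤ k) (hg0 : 0 ≤ g)
    (hg : g * (β - 1) ≤ t * (k - t))
    (hc1 : β + 1 - c1 ≤ t) (hc2 : β + 1 - c2 ≤ t) (hsum : c1 + c2 + t ≤ 2 * β)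
    (he1 : c1 * (β + 1 - c1) ≤ e1) (he2 : c2 * (β + 1 - c2) ≤ e2)
    (hE : e1 + e2 + t * (t - 1) ≤ k * t + g) : False := by
  obtain ⟨y1, rfl⟩ : ∃ y, c1 = β + 1 - y := ⟨β + 1 - c1, by ring⟩
  obtain ⟨y2, rfl⟩ : ∃ y, c2 = β + 1 - y := ⟨β + 1 - c2, by ring⟩
  have a1 : y1 ≤ t := by linarith
  have a2 : y2 ≤ t := by linarith
  have a3 : t + 2 ≤ y1 + y2 := by linarith
  have b1 : (β + 1 - t) * y1 ≤ e1 := by nlinarith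
  have b2 : (β + 1 - t) * y2 ≤ e2 := by nlinarith
  have b3 : (β + 1 - t) * (t + 2) ≤ e1 + e2 := by nlinarith
  have b4 : (2 * k - t) * (t + 2) ≤ e1 + e2 := by nlinarith
  have b5 : g ≤ k := by nlinarith [sq_nonneg (2 * t - k)]
  nlinarith

/-- the final numeric contradiction. -/
theorem caseZ (k β t l c0 c1 e0 e1 : ℤ) (hk : 3 ≤ k) (hβ : 2 * k - 1 ≤ β) (ht : 0 ≤ t)
    (htk : t ≤ k) (hl0 : 0 ≤ l) (hl : 1 ≤ t → l ≤ k + 1 - t)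
    (hc0 : β + 1 - c0 ≤ t) (hc1 : β + 1 - c1 ≤ t) (hsum : c0 + c1 + t ≤ 2 * β)
    (he0 : (c0 - l) * (β + 1 - c0) ≤ e0) (he1 : c1 * (β + 1 - c1) ≤ e1)
    (hE : e0 + e1 + t * (t - 1) ≤ k * t) : False := by
  obtain ⟨y1, rfl⟩ : ∃ y, c1 = β + 1 - y := ⟨β + 1 - c1, by ring⟩
  obtain ⟨y0, rfl⟩ : ∃ y, c0 = β + 1 - y := ⟨β + 1 - c0, by ring⟩
  have a1 : y1 ≤ t := by linarith
  have a2 : y0 ≤ t := by linarith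
  have a3 : t + 2 ≤ y0 + y1 := by linarith
  have hl' := hl (by linarith)
  have b1 : k * y1 ≤ e1 := by nlinarith
  have b2 : (k - 1) * y0 ≤ e0 := by nlinarith
  nlinarith

set_option maxHeartbeats 2000000 in
theorem core (k ν s t h EL EH lam c0 : ℤ) {ι : Type u} (J : Finset ι) (c e : ι → ℤ)
    (hk : 3 ≤ k) (hν : 2 * k - 1 ≤ ν)
    (hs : 0 ≤ s) (ht : 0 ≤ t) (hh : 0 ≤ h) (hEL0 : 0 ≤ EL) (hEH0 : 0 ≤ EH)
    (H1 : t * (t - 1) + lam * t ≤ EL) (H2 : t * (k - s) ≤ EL) (H3 : (ν - s) * h ≤ EH)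
    (H4 : k * s + EL + EH + 2 ≤ k * (t + h) + (J.card + lam))
    (hlam : lam = 0 ∨ lam = 1) (hc0 : lam ≤ c0)
    (hsize : s + t + h + ∑ i ∈ J, c i + c0 ≤ 2 * ν)
    (hc : ∀ i ∈ J, 1 ≤ c i) (he : ∀ i ∈ J, c i * (ν - s + 1 - c i) ≤ e i)
    (hce : ∀ i ∈ J, ν - s + 1 - c i ≤ t + h) (he0 : ∀ i ∈ J, 0 ≤ e i)
    (hE : ∑ i ∈ J, e i + lam * t + t * (t - 1) ≤ EL + EH) :
    s = 0 ∧ h = 0 ∧ EL ≤ k * t ∧ lam = 1 ∧ J.card = 1 ∧ t ≤ k := by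
  classical
  have hlam0 : 0 ≤ lam := by omega
  have hlt : 0 ≤ lam * t := mul_nonneg hlam0 ht
  have H1' : t * (t - 1) ≤ EL := by linarith
  have hJc : (J.card : ℤ) ≤ ∑ i ∈ J, c i := by
    have := Finset.sum_le_sum hc
    simpa using this
  obtain ⟨q, hq⟩ : ∃ q : ℤ, q = J.card + lam := ⟨_, rfl⟩
  rw [← hq] at H4
  have hβk : k ≤ ν - s := regimeI k ν s t h q EL EH hk hν hs ht hh (by omega) hEL0 hEH0 H1' H3 H4
    (by linarith)
  obtain ⟨β, rfl⟩ : ∃ β, ν = β + s := ⟨ν - s, by ring⟩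
  have eb : β + s - s = β := by ring
  simp only [eb] at *
  obtain ⟨D, hD⟩ : ∃ D : ℤ, D = k * s + EL - k * t := ⟨_, rfl⟩
  obtain ⟨g, hg⟩ : ∃ g : ℤ, g = q - 2 := ⟨_, rfl⟩
  have hD1 : s * (k - t) ≤ D := hD ▸ D_bound1 k s t EL H2
  have hD2 : k + 1 ≤ t → k * s ≤ D := fun h => hD ▸ D_bound2 k s t EL h hk H1'
  have hDg : h * (β - k) ≤ g - D := by nlinarith
  have hDg' : D ≤ g := by nlinarith [mul_nonneg hh (sub_nonneg.2 hβk)]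
  have hD0 : 0 ≤ D := by
    rcases le_or_gt t k with htk | htk
    · nlinarith [mul_nonneg hs (sub_nonneg.2 htk)]
    · nlinarith [hD2 (by omega), mul_nonneg (show (0:ℤ) ≤ k by linarith) hs]
  -- the big pieces
  set B := J.filter (fun i => β + 1 ≤ c i) with hB
  have hsumc : (J.card : ℤ) + β * B.card ≤ ∑ i ∈ J, c i := by
    have h1 : ∑ i ∈ J, (1 + if β + 1 ≤ c i then β else 0) ≤ ∑ i ∈ J, c i := by
      refine Finset.sum_le_sum fun i hi => ?_
      have := hc i hi
      split_ifs <;> linarith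
    rw [Finset.sum_add_distrib, ← Finset.sum_filter, Finset.sum_const, Finset.sum_const] at h1
    simp only [nsmul_eq_mul, mul_one] at h1
    rw [← hB] at h1
    linarith
  have hsume : β * (J.card - B.card) ≤ ∑ i ∈ J, e i := by
    have h1 : ∑ i ∈ J, (β - if β + 1 ≤ c i then β else 0) ≤ ∑ i ∈ J, e i := by
      refine Finset.sum_le_sum fun i hi => ?_
      have h1 := hc i hi
      have h2 := he i hi
      have h3 := he0 i hi
      split_ifs with hcase
      · linarith
      · push Not at hcase
        have : 0 ≤ (c i - 1) * (β - c i) := mul_nonneg (by linarith) (by linarith)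
        nlinarith
    rw [Finset.sum_sub_distrib, ← Finset.sum_filter, Finset.sum_const, Finset.sum_const] at h1
    simp only [nsmul_eq_mul] at h1
    rw [← hB] at h1
    linarith
  obtain ⟨m, hm⟩ : ∃ m : ℤ, m = B.card := ⟨_, rfl⟩
  rw [← hm] at hsumc hsume
  have hm0 : 0 ≤ m := by omega
  have hm1 : m ≤ 1 := by
    by_contra hcon
    have h2 : 2 ≤ m := by omega
    have h3 : β * 2 ≤ β * m := mul_le_mul_of_nonneg_left h2 (by linarith)
    have h4 : q + t + h ≤ s := by linarith
    have h5 : k * (s - t) ≤ D := by nlinarith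
    nlinarith
  have hm01 : m = 0 ∨ m = 1 := by omega
  have hJ : (J.card : ℤ) = g + 2 - lam := by omega
  rw [hJ] at hsume hsumc
  have hEE : β * (g + 2 - lam - m) + lam * t + t * (t - 1) ≤ k * (t + h) + g - k * s := by
    linarith
  have hs1 : t ≤ k → g * (β - 1) ≤ t * (k - t) - k * s + k * h - (1 - m) * β := by
    intro htk
    rcases hlam with rfl | rfl <;> nlinarith
  have hs2 : k + 1 ≤ t → g * (β - 1) ≤ - k * s + k * h - (1 - m) * β := by
    intro htk
    have : 0 ≤ t * (t - (k + 1)) := mul_nonneg ht (by linarith)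
    rcases hlam with rfl | rfl <;> nlinarith
  have hmb : 0 ≤ (1 - m) * β := mul_nonneg (by linarith) (by linarith)
  rcases eq_or_lt_of_le hs with hs0 | hspos
  · subst hs0
    have hh0 : h = 0 := caseC_h k β t h g hk (by linarith) ht hh (by linarith)
      (fun h => by linarith [hs1 h]) (fun h => by linarith [hs2 h])
    subst hh0
    have htk : t ≤ k := by
      by_contra hcon
      have htk : k + 1 ≤ t := by omega
      have h1 := hs2 htk
      have hg0 : g ≤ 0 := by
        by_contra hgp
        have : 0 < g * (β - 1) := mul_pos (by linarith) (by linarith)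
        linarith
      rcases hlam with rfl | rfl
      · have hgz : g = 0 := by omega
        subst hgz
        have : 0 ≤ t * (t - (k + 1)) := mul_nonneg ht (by linarith)
        rcases hm01 with rfl | rfl <;> nlinarith
      · nlinarith
    have hJ1 : J.card ≤ 1 := by
      by_contra hcon
      push Not at hcon
      obtain ⟨i, hi, j, hj, hij⟩ := Finset.one_lt_card.1 hcon
      have hsub : ({i, j} : Finset ι) ⊆ J := by
        intro x hx; simp at hx; rcases hx with rfl | rfl <;> assumption
      have s1 : c i + c j ≤ ∑ i ∈ J, c i := by
        rw [← Finset.sum_pair hij]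
        exact Finset.sum_le_sum_of_subset_of_nonneg hsub (fun x hx _ => by linarith [hc x hx])
      have s2 : e i + e j ≤ ∑ i ∈ J, e i := by
        rw [← Finset.sum_pair hij]
        exact Finset.sum_le_sum_of_subset_of_nonneg hsub (fun x hx _ => he0 x hx)
      exact caseC_two k β t g (c i) (c j) (e i) (e j) hk (by linarith) ht htk (by linarith)
        (by linarith [hs1 htk]) (by linarith [hce i hi]) (by linarith [hce j hj]) (by linarith)
        (he i hi) (he j hj) (by linarith)
    refine ⟨rfl, rfl, ?_, by omega, by omega, htk⟩
    have : g = 0 := by omega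
    linarith
  · exfalso
    rcases eq_or_lt_of_le hβk with hbk | hbk
    · subst hbk
      rcases hm01 with rfl | rfl
      · exact caseB2 k s t h g D EL hk (by linarith) ht hD H1' hD1 hD2 hDg' (by linarith)
          (by linarith) (fun h => by linarith [hs1 h]) (fun h => by linarith [hs2 h])
      · exact caseB1 k s t h g D hk (by linarith) ht hD1 hD2 hDg' (by linarith)
          (by linarith) (fun h => by linarith [hs1 h]) (fun h => by linarith [hs2 h])
    · exact caseA k β s t h g D hk (by linarith) hh (by linarith) hD1 hD2 hDg
        (fun h => by linarith [hs1 h]) (fun h => by linarith [hs2 h])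


open Classical in
/-- degree as a filter cardinality -/
noncomputable def fdeg {V : Type u} [Fintype V] (G : SimpleGraph V) (v : V) : ℕ :=
  (Finset.univ.filter (G.Adj v)).card

open Classical in
/-- degree outside `S` -/
noncomputable def odeg {V : Type u} [Fintype V] (G : SimpleGraph V) (S : Finset V) (v : V) : ℕ :=
  (Finset.univ.filter (fun w => w ∉ S ∧ G.Adj v w)).card

open Classical in
/-- degree into `T` -/
noncomputable def tdeg {V : Type u} (G : SimpleGraph V) (T : Finset V) (v : V) : ℕ :=
  (T.filter (G.Adj v)).card

open Classical in
/-- the pieces -/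
noncomputable def piece {V ι : Type u} [Fintype V] (S T : Finset V) (c : V → ι) (i : ι) :
    Finset V := Finset.univ.filter (fun v => v ∉ S ∧ v ∉ T ∧ c v = i)

theorem mem_piece {V ι : Type u} [Fintype V] (S T : Finset V) (c : V → ι) (i : ι) (v : V) :
    v ∈ piece S T c i ↔ v ∉ S ∧ v ∉ T ∧ c v = i := by simp [piece]

theorem fdeg_le {V : Type u} [Fintype V] (G : SimpleGraph V) (S : Finset V) (v : V) :
    fdeg G v ≤ S.card + odeg G S v := by
  classical
  unfold fdeg odeg
  refine le_trans (Finset.card_le_card ?_) (Finset.card_union_le _ _)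
  intro w hw
  simp at hw ⊢
  tauto

theorem fdeg_piece {V ι : Type u} [Fintype V] (G : SimpleGraph V) (S T : Finset V) (c : V → ι)
    (hc : ∀ v w, G.Adj v w → v ∉ S → v ∉ T → w ∉ S → w ∉ T → c v = c w) (i : ι) (v : V)
    (hv : v ∈ piece S T c i) :
    fdeg G v + 1 ≤ S.card + (piece S T c i).card + tdeg G T v := by
  classical
  have h1 : fdeg G v ≤ (S ∪ (piece S T c i).erase v ∪ T.filter (G.Adj v)).card := by
    unfold fdeg
    apply Finset.card_le_card
    intro w hw
    have hw : G.Adj v w := by simpa using hw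
    by_cases hS : w ∈ S
    · simp [hS]
    by_cases hT : w ∈ T
    · simp [hT, hw]
    have hvv := (mem_piece S T c i v).1 hv
    have := hc v w hw hvv.1 hvv.2.1 hS hT
    have : w ∈ piece S T c i := (mem_piece S T c i w).2 ⟨hS, hT, by rw [← this]; exact hvv.2.2⟩
    simp [this, hw.ne']
  have h2 := Finset.card_union_le (S ∪ (piece S T c i).erase v) (T.filter (G.Adj v))
  have h3 := Finset.card_union_le S ((piece S T c i).erase v)
  have h4 := Finset.card_erase_add_one hv
  unfold tdeg
  omega

theorem piece_bounds {V ι : Type u} [Fintype V] (G : SimpleGraph V) (S T : Finset V) (c : V → ι)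
    (hc : ∀ v w, G.Adj v w → v ∉ S → v ∉ T → w ∉ S → w ∉ T → c v = c w) (i : ι) (ν : ℕ)
    (L : Finset V) (hL : L ⊆ piece S T c i)
    (hhi : ∀ v ∈ L, ν ≤ fdeg G v) :
    (L.card : ℤ) * ((ν : ℤ) - S.card + 1 - (piece S T c i).card) ≤
      ((∑ v ∈ piece S T c i, tdeg G T v : ℕ) : ℤ) ∧
    (L.Nonempty → (ν : ℤ) - S.card + 1 - (piece S T c i).card ≤ T.card) := by
  classical
  have key : ∀ v ∈ L, (ν : ℤ) - S.card + 1 - (piece S T c i).card ≤ (tdeg G T v : ℤ) := by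
    intro v hv
    have := fdeg_piece G S T c hc i v (hL hv)
    have := hhi v hv
    omega
  constructor
  · have h1 := Finset.card_nsmul_le_sum L (fun v => (tdeg G T v : ℤ)) _ key
    have h2 : ∑ v ∈ L, (tdeg G T v : ℤ) ≤ ∑ v ∈ piece S T c i, (tdeg G T v : ℤ) :=
      Finset.sum_le_sum_of_subset_of_nonneg hL (fun _ _ _ => by positivity)
    push_cast
    rw [nsmul_eq_mul] at h1
    linarith
  · rintro ⟨v, hv⟩
    have := key v hv
    have h3 : tdeg G T v ≤ T.card := Finset.card_filter_le _ _
    omega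

theorem edge_count {V ι : Type u} [Fintype V] (G : SimpleGraph V) (S T TL : Finset V) (c : V → ι)
    (I : Finset ι) (hST : Disjoint S T) (hTL : TL ⊆ T)
    (hcl : ∀ u ∈ TL, ∀ w ∈ TL, u ≠ w → G.Adj u w) :
    ((∑ i ∈ I, ∑ v ∈ piece S T c i, tdeg G T v : ℕ) : ℤ) + TL.card * ((TL.card : ℤ) - 1) ≤
      ((∑ x ∈ T, odeg G S x : ℕ) : ℤ) := by
  classical
  have hswap : ∑ i ∈ I, ∑ v ∈ piece S T c i, tdeg G T v =
      ∑ x ∈ T, ∑ i ∈ I, ((piece S T c i).filter (G.Adj x)).card := by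
    rw [Finset.sum_comm]
    refine Finset.sum_congr rfl fun i _ => ?_
    unfold tdeg
    have := Finset.sum_card_bipartiteAbove_eq_sum_card_bipartiteBelow
      (s := piece S T c i) (t := T) (r := G.Adj)
    simp only [Finset.bipartiteAbove, Finset.bipartiteBelow] at this
    rw [this]
    simp only [G.adj_comm]
  have hx : ∀ x ∈ T, (∑ i ∈ I, ((piece S T c i).filter (G.Adj x)).card) +
      (if x ∈ TL then TL.card - 1 else 0) ≤ odeg G S x := by
    intro x hx
    have h1 : ∑ i ∈ I, ((piece S T c i).filter (G.Adj x)).card =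
        (I.biUnion fun i => (piece S T c i).filter (G.Adj x)).card := by
      rw [Finset.card_biUnion]
      intro i _ j _ hij
      rw [Function.onFun, Finset.disjoint_left]
      intro v hv hv'
      simp only [Finset.mem_filter, mem_piece] at hv hv'
      exact hij (hv.1.2.2.symm.trans hv'.1.2.2)
    have h2 : (if x ∈ TL then TL.card - 1 else 0) =
        (if x ∈ TL then TL.erase x else ∅).card := by
      split_ifs with h
      · rw [Finset.card_erase_of_mem h]
      · rfl
    rw [h1, h2, ← Finset.card_union_of_disjoint]
    · unfold odeg
      apply Finset.card_le_card
      intro w hw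
      simp only [Finset.mem_union, Finset.mem_biUnion, Finset.mem_filter, mem_piece] at hw
      simp only [Finset.mem_filter, Finset.mem_univ, true_and]
      rcases hw with ⟨i, _, h, h'⟩ | hw
      · exact ⟨h.1, h'⟩
      · split_ifs at hw with hxl
        · have hw' := Finset.mem_erase.1 hw
          exact ⟨fun h => (Finset.disjoint_left.1 hST) h (hTL hw'.2),
            hcl x hxl w hw'.2 (Ne.symm hw'.1)⟩
        · simp at hw
    · rw [Finset.disjoint_left]
      intro w hw hw'
      simp only [Finset.mem_biUnion, Finset.mem_filter, mem_piece] at hw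
      obtain ⟨i, _, h, _⟩ := hw
      split_ifs at hw'
      · exact h.2.1 (hTL (Finset.mem_erase.1 hw').2)
      · simp at hw'
  have hs := Finset.sum_le_sum hx
  rw [Finset.sum_add_distrib, ← Finset.sum_filter, Finset.sum_const, ← hswap,
    Finset.filter_mem_eq_inter, Finset.inter_eq_right.2 hTL, smul_eq_mul] at hs
  have h3 : ((TL.card * (TL.card - 1) : ℕ) : ℤ) = TL.card * ((TL.card : ℤ) - 1) := by
    rcases Nat.eq_zero_or_pos TL.card with h | h
    · simp [h]
    · push_cast [Nat.cast_sub h]; ring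
  rw [← h3]
  exact_mod_cast hs

theorem size_count {V ι : Type u} [Fintype V] (S T : Finset V) (c : V → ι)
    (I : Finset ι) (hST : Disjoint S T) :
    S.card + T.card + ∑ i ∈ I, (piece S T c i).card ≤ Fintype.card V := by
  classical
  have h1 : ∑ i ∈ I, (piece S T c i).card = (I.biUnion (piece S T c)).card := by
    rw [Finset.card_biUnion]
    intro i _ j _ hij
    rw [Function.onFun, Finset.disjoint_left]
    intro v hv hv'
    simp only [mem_piece] at hv hv'
    exact hij (hv.2.2.symm.trans hv'.2.2)
  rw [h1, ← Finset.card_union_of_disjoint hST, ← Finset.card_union_of_disjoint]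
  · exact Finset.card_le_univ _
  · rw [Finset.disjoint_left]
    intro v hv hv'
    simp only [Finset.mem_biUnion, mem_piece, Finset.mem_union] at hv hv'
    obtain ⟨i, _, h⟩ := hv'
    tauto


theorem no_barrier {V ι : Type u} [Fintype V] (G : SimpleGraph V) (k ν : ℕ) (hk : 3 ≤ k)
    (hν : 2 * k - 1 ≤ ν) (hcard : Fintype.card V ≤ 2 * ν) (hconn : G.Connected)
    (hδ : ∀ v, k ≤ fdeg G v)
    (hdeg : ∀ u w, fdeg G u < ν → fdeg G w < ν → u ≠ w → G.Adj u w)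
    (S T : Finset V) (c : V → ι) (I : Finset ι) (hST : Disjoint S T)
    (hc : ∀ v w, G.Adj v w → v ∉ S → v ∉ T → w ∉ S → w ∉ T → c v = c w)
    (hne : ∀ i ∈ I, (piece S T c i).Nonempty)
    (hbar : k * S.card + ∑ x ∈ T, odeg G S x + 2 ≤ k * T.card + I.card) : False := by
  classical
  obtain ⟨TL, hTL⟩ : ∃ A, A = T.filter (fun v => fdeg G v < ν) := ⟨_, rfl⟩
  obtain ⟨TH, hTH⟩ : ∃ A, A = T.filter (fun v => ¬ fdeg G v < ν) := ⟨_, rfl⟩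
  have hTLT : TL ⊆ T := hTL ▸ Finset.filter_subset _ _
  have memTL : ∀ x, x ∈ TL ↔ x ∈ T ∧ fdeg G x < ν := by intro x; rw [hTL]; simp
  have hTc : TL.card + TH.card = T.card := by
    rw [hTL, hTH]; exact Finset.card_filter_add_card_filter_not _
  have hTs : ∑ x ∈ TL, odeg G S x + ∑ x ∈ TH, odeg G S x = ∑ x ∈ T, odeg G S x := by
    rw [hTL, hTH]; exact Finset.sum_filter_add_sum_filter_not _ _ _
  have hcl : ∀ u ∈ TL, ∀ w ∈ TL, u ≠ w → G.Adj u w := fun u hu w hw h =>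
    hdeg u w ((memTL u).1 hu).2 ((memTL w).1 hw).2 h
  have hcount := edge_count G S T TL c I hST hTLT hcl
  have hsz := size_count S T c I hST
  have H2 : (TL.card : ℤ) * ((k : ℤ) - S.card) ≤ ((∑ x ∈ TL, odeg G S x : ℕ) : ℤ) := by
    have := Finset.card_nsmul_le_sum TL (fun v => (odeg G S v : ℤ)) ((k : ℤ) - S.card)
      (fun x _ => by have := fdeg_le G S x; have := hδ x; omega)
    rw [nsmul_eq_mul] at this
    push_cast; exact this
  have H3 : ((ν : ℤ) - S.card) * TH.card ≤ ((∑ x ∈ TH, odeg G S x : ℕ) : ℤ) := by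
    have := Finset.card_nsmul_le_sum TH (fun v => (odeg G S v : ℤ)) ((ν : ℤ) - S.card)
      (fun x hx => by
        have := fdeg_le G S x
        rw [hTH] at hx
        have := (Finset.mem_filter.1 hx).2
        omega)
    rw [nsmul_eq_mul] at this
    push_cast; linarith
  -- lower bound on `odeg` for low vertices
  have hod : ∀ A : Finset V, (∀ v ∈ A, v ∉ S ∧ fdeg G v < ν) → ∀ x ∈ TL,
      (A.erase x).card ≤ odeg G S x := by
    intro A hA x hx
    apply Finset.card_le_card
    intro w hw
    have hw' := Finset.mem_erase.1 hw
    simp only [Finset.mem_filter, Finset.mem_univ, true_and]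
    exact ⟨(hA w hw'.2).1, hdeg x w ((memTL x).1 hx).2 (hA w hw'.2).2 (Ne.symm hw'.1)⟩
  have hTLS : ∀ v ∈ TL, v ∉ S ∧ fdeg G v < ν := fun v hv =>
    ⟨fun h => Finset.disjoint_left.1 hST h (hTLT hv), ((memTL v).1 hv).2⟩
  have H4 : (k : ℤ) * S.card + ((∑ x ∈ TL, odeg G S x : ℕ) : ℤ) +
      ((∑ x ∈ TH, odeg G S x : ℕ) : ℤ) + 2 ≤ k * ((TL.card : ℤ) + TH.card) + I.card := by
    rw [← hTs, ← hTc] at hbar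
    zify at hbar
    push_cast
    linarith
  rw [← hTs] at hcount
  push_cast at hcount
  have hc1 : ∀ i ∈ I, (1 : ℤ) ≤ ((piece S T c i).card : ℤ) := fun i hi => by
    exact_mod_cast (hne i hi).card_pos
  have hszz : (S.card : ℤ) + TL.card + TH.card + ∑ i ∈ I, ((piece S T c i).card : ℤ) ≤ 2 * ν := by
    have : S.card + T.card + ∑ i ∈ I, (piece S T c i).card ≤ 2 * ν := hsz.trans hcard
    rw [← hTc] at this
    zify at this
    linarith
  by_cases hz : ∃ i0 ∈ I, ∃ z ∈ piece S T c i0, fdeg G z < ν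
  swap
  · push Not at hz
    have h1 := core (k : ℤ) ν S.card TL.card TH.card ((∑ x ∈ TL, odeg G S x : ℕ) : ℤ)
      ((∑ x ∈ TH, odeg G S x : ℕ) : ℤ) 0 0 I (fun i => ((piece S T c i).card : ℤ))
      (fun i => ((∑ v ∈ piece S T c i, tdeg G T v : ℕ) : ℤ)) (by exact_mod_cast hk) (by omega)
      (by positivity) (by positivity) (by positivity) (by positivity) (by positivity)
      (by
        have := Finset.card_nsmul_le_sum TL (fun v => (odeg G S v : ℤ)) ((TL.card : ℤ) - 1)
          (fun x hx => by
            have h1 := hod TL hTLS x hx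
            have h2 := Finset.card_erase_add_one hx
            omega)
        rw [nsmul_eq_mul] at this
        push_cast; linarith)
      H2 H3 (by linarith) (Or.inl rfl) le_rfl (by linarith) hc1
      (fun i hi => (piece_bounds G S T c hc i ν _ (Finset.Subset.refl _) (hz i hi)).1)
      (fun i hi => by
        have := (piece_bounds G S T c hc i ν _ (Finset.Subset.refl _) (hz i hi)).2 (hne i hi)
        have := hTc
        omega)
      (fun i hi => by positivity)
      (by push_cast; linarith)
    exact absurd h1.2.2.2.1 (by norm_num)
  obtain ⟨i0, hi0, z, hz, hzl⟩ := hz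
  have hzp := (mem_piece S T c i0 z).1 hz
  have hhigh : ∀ i ∈ I.erase i0, ∀ v ∈ piece S T c i, ν ≤ fdeg G v := by
    intro i hi v hv
    by_contra hcon
    push Not at hcon
    have hvp := (mem_piece S T c i v).1 hv
    have hne : i ≠ i0 := (Finset.mem_erase.1 hi).1
    have hvz : v ≠ z := by
      rintro rfl
      exact hne (hvp.2.2.symm.trans hzp.2.2)
    have := hc v z (hdeg v z hcon hzl hvz) hvp.1 hvp.2.1 hzp.1 hzp.2.1
    exact hne (hvp.2.2.symm.trans (this.trans hzp.2.2))
  have hIc := Finset.card_erase_add_one hi0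
  have hsumc := Finset.add_sum_erase I (fun i => ((piece S T c i).card : ℤ)) hi0
  have hsume := Finset.add_sum_erase I
    (fun i => ∑ v ∈ piece S T c i, (tdeg G T v : ℤ)) hi0
  have hztd : (TL.card : ℤ) ≤ ∑ v ∈ piece S T c i0, (tdeg G T v : ℤ) := by
    have h1 : TL.card ≤ tdeg G T z := by
      apply Finset.card_le_card
      intro x hx
      refine Finset.mem_filter.2 ⟨hTLT hx, hdeg z x hzl ((memTL x).1 hx).2 ?_⟩
      rintro rfl
      exact hzp.2.1 (hTLT hx)
    have h2 := Finset.single_le_sum (f := fun v => tdeg G T v) (s := piece S T c i0)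
      (fun _ _ => Nat.zero_le _) hz
    have h3 : TL.card ≤ ∑ v ∈ piece S T c i0, tdeg G T v := h1.trans h2
    exact_mod_cast h3
  have h1 := core (k : ℤ) ν S.card TL.card TH.card ((∑ x ∈ TL, odeg G S x : ℕ) : ℤ)
      ((∑ x ∈ TH, odeg G S x : ℕ) : ℤ) 1 (piece S T c i0).card (I.erase i0)
      (fun i => ((piece S T c i).card : ℤ))
      (fun i => ((∑ v ∈ piece S T c i, tdeg G T v : ℕ) : ℤ)) (by exact_mod_cast hk) (by omega)
      (by positivity) (by positivity) (by positivity) (by positivity) (by positivity)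
      (by
        have hzTL : z ∉ TL := fun h => hzp.2.1 (hTLT h)
        have := Finset.card_nsmul_le_sum TL (fun v => (odeg G S v : ℤ)) (TL.card : ℤ)
          (fun x hx => by
            have h1 := hod (insert z TL) (by
              intro v hv
              rcases Finset.mem_insert.1 hv with rfl | hv
              · exact ⟨hzp.1, hzl⟩
              · exact hTLS v hv) x hx
            have h2 := Finset.card_erase_add_one (Finset.mem_insert_of_mem (b := z) hx)
            rw [Finset.card_insert_of_notMem hzTL] at h2
            omega)
        rw [nsmul_eq_mul] at this
        push_cast; linarith)
      H2 H3 (by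
        have : (I.card : ℤ) = (I.erase i0).card + 1 := by exact_mod_cast hIc.symm
        linarith) (Or.inr rfl) (hc1 i0 hi0) (by linarith)
      (fun i hi => hc1 i (Finset.mem_of_mem_erase hi))
      (fun i hi => (piece_bounds G S T c hc i ν _ (Finset.Subset.refl _) (hhigh i hi)).1)
      (fun i hi => by
        have := (piece_bounds G S T c hc i ν _ (Finset.Subset.refl _) (hhigh i hi)).2
          (hne i (Finset.mem_of_mem_erase hi))
        have := hTc
        omega)
      (fun i hi => by positivity)
      (by push_cast; linarith)
  obtain ⟨hs0, hh0, hEL, -, hJ1, htk⟩ := h1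
  have hS : S = ∅ := Finset.card_eq_zero.1 (by exact_mod_cast hs0)
  have hTH0 : TH.card = 0 := by exact_mod_cast hh0
  have hTHe : TH = ∅ := Finset.card_eq_zero.1 hTH0
  have hTT : TL = T := Finset.eq_of_subset_of_card_le hTLT (by omega)
  obtain ⟨j, hj⟩ := Finset.card_eq_one.1 hJ1
  have hjI : j ∈ I.erase i0 := by rw [hj]; exact Finset.mem_singleton_self j
  have hjI' := Finset.mem_of_mem_erase hjI
  have hij : j ≠ i0 := (Finset.mem_erase.1 hjI).1
  subst hS
  have hodf : ∀ x, odeg G ∅ x = fdeg G x := by intro x; unfold odeg fdeg; simp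
  -- all degrees in `T` equal `k`
  have hdk : ∀ x ∈ T, fdeg G x = k := by
    have hle : ∑ x ∈ T, fdeg G x ≤ ∑ x ∈ T, k := by
      rw [hTT] at hEL
      simp only [hodf] at hEL
      rw [Finset.sum_const, smul_eq_mul, mul_comm]
      exact_mod_cast hEL
    have heq := (Finset.sum_eq_sum_iff_of_le (fun x (_ : x ∈ T) => hδ x)).1
      (le_antisymm (Finset.sum_le_sum fun x _ => hδ x) hle)
    exact fun x hx => (heq x hx).symm
  have hTlow : ∀ x ∈ T, fdeg G x < ν := fun x hx => ((memTL x).1 (hTT ▸ hx)).2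
  obtain ⟨L, hL⟩ : ∃ A, A = (piece ∅ T c i0).filter (fun v => fdeg G v < ν) := ⟨_, rfl⟩
  obtain ⟨Hi, hHi⟩ : ∃ A, A = (piece ∅ T c i0).filter (fun v => ¬ fdeg G v < ν) := ⟨_, rfl⟩
  have hLH : L.card + Hi.card = (piece ∅ T c i0).card := by
    rw [hL, hHi]; exact Finset.card_filter_add_card_filter_not _
  have hLT : Disjoint L T := by
    rw [Finset.disjoint_left]
    intro v hv
    rw [hL, Finset.mem_filter, mem_piece] at hv
    exact hv.1.2.1
  have hLTlow : ∀ v ∈ L ∪ T, fdeg G v < ν := by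
    intro v hv
    rcases Finset.mem_union.1 hv with hv | hv
    · rw [hL] at hv; exact (Finset.mem_filter.1 hv).2
    · exact hTlow v hv
  have hsubx : ∀ x ∈ T, (L ∪ T).erase x ⊆ Finset.univ.filter (G.Adj x) := by
    intro x hx w hw
    have hw' := Finset.mem_erase.1 hw
    simp only [Finset.mem_filter, Finset.mem_univ, true_and]
    exact hdeg x w (hTlow x hx) (hLTlow w hw'.2) (Ne.symm hw'.1)
  have hLTc : (L ∪ T).card = L.card + T.card := Finset.card_union_of_disjoint hLT
  rcases Hi.eq_empty_or_nonempty with hHe | hHne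
  · -- the low piece is a clique
    have hLp : L = piece ∅ T c i0 := by
      apply Finset.eq_of_subset_of_card_le
      · rw [hL]; exact Finset.filter_subset _ _
      · rw [hHe] at hLH; simp at hLH; omega
    have hzd := fdeg_piece G ∅ T c hc i0 z hz
    have hzT : tdeg G T z ≤ T.card := Finset.card_filter_le _ _
    have hkz := hδ z
    rw [← hLp] at hzd
    simp only [Finset.card_empty] at hzd
    have hclosed : ∀ a b, G.Adj a b → a ∈ L ∪ T → b ∈ L ∪ T := by
      intro a b hab ha
      by_cases haT : a ∈ T
      · have heq : (L ∪ T).erase a = Finset.univ.filter (G.Adj a) := by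
          apply Finset.eq_of_subset_of_card_le (hsubx a haT)
          have h1 := hdk a haT
          unfold fdeg at h1
          have h2 := Finset.card_erase_add_one ha
          omega
        have : b ∈ (L ∪ T).erase a := by rw [heq]; simp [hab]
        exact Finset.mem_of_mem_erase this
      · by_cases hbT : b ∈ T
        · exact Finset.mem_union_right _ hbT
        · have haL : a ∈ L := (Finset.mem_union.1 ha).resolve_right haT
          rw [hLp, mem_piece] at haL
          apply Finset.mem_union_left
          rw [hLp, mem_piece]
          exact ⟨by simp, hbT, (hc a b hab (by simp) haT (by simp) hbT).symm.trans haL.2.2⟩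
    obtain ⟨y, hy⟩ := hne j hjI'
    obtain ⟨p⟩ := hconn.preconnected z y
    have hwalk : ∀ a b (p : G.Walk a b), a ∈ L ∪ T → b ∈ L ∪ T := by
      intro a b p
      induction p with
      | nil => exact id
      | cons hab _ ih => exact fun ha => ih (hclosed _ _ hab ha)
    have hyA := hwalk z y p (Finset.mem_union_left _ (hLp ▸ hz))
    have hyp := (mem_piece ∅ T c j y).1 hy
    rcases Finset.mem_union.1 hyA with h | h
    · rw [hLp, mem_piece] at h
      exact hij (hyp.2.2.symm.trans h.2.2)
    · exact hyp.2.1 h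
  · have b0 := piece_bounds G ∅ T c hc i0 ν Hi (by rw [hHi]; exact Finset.filter_subset _ _)
      (fun v hv => by rw [hHi] at hv; exact not_lt.1 (Finset.mem_filter.1 hv).2)
    have b1 := piece_bounds G ∅ T c hc j ν _ (Finset.Subset.refl _) (hhigh j hjI)
    have b02 := b0.2 hHne
    have b12 := b1.2 (hne j hjI')
    have b01 := b0.1
    have b11 := b1.1
    simp only [Finset.card_empty, Nat.cast_zero, sub_zero] at b01 b02 b11 b12
    rw [hj, Finset.sum_singleton] at hsumc hsume
    rw [hTHe] at hcount hszz
    rw [hTT] at hcount hszz hEL htk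
    simp only [Finset.sum_empty, Finset.card_empty, Nat.cast_zero] at hcount hszz
    refine caseZ k ν T.card L.card (piece ∅ T c i0).card (piece ∅ T c j).card
      ((∑ v ∈ piece ∅ T c i0, tdeg G T v : ℕ) : ℤ) ((∑ v ∈ piece ∅ T c j, tdeg G T v : ℕ) : ℤ)
      (by exact_mod_cast hk) (by omega) (Int.natCast_nonneg _) htk (Int.natCast_nonneg _) ?_ b02 b12
      (by linarith) ?_ b11 ?_
    · intro ht
      have hT0 : 0 < T.card := by omega
      obtain ⟨x, hx⟩ := Finset.card_pos.1 hT0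
      have h1 := Finset.card_le_card (hsubx x hx)
      have h2 := hdk x hx
      unfold fdeg at h2
      have h3 := Finset.card_erase_add_one (Finset.mem_union_right L hx)
      omega
    · have : ((piece ∅ T c i0).card : ℤ) - L.card = Hi.card := by omega
      rw [this]; exact b01
    · push_cast at hEL ⊢
      linarith

theorem ncard_neighborSet_eq {V : Type u} [Fintype V] (G : SimpleGraph V) (v : V) :
    (G.neighborSet v).ncard = fdeg G v := by
  classical
  unfold fdeg
  rw [← Set.ncard_coe_finset]
  congr 1
  ext w
  simp

/-- Let `k ≥ 3`, `k·n` even, and `G` a connected graph of order `n ≥ 4k-3` with minimum degree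
at least `k`. If `max{d_G(u), d_G(w)} ≥ n/2` for every pair of nonadjacent vertices `u, w`,
then `G` contains a `k`-factor. -/
theorem k_factor_of_degree_condition
    {V : Type*} [Fintype V] (G : SimpleGraph V) (n k : ℕ)
    (hk : 3 ≤ k) (hcard : Fintype.card V = n) (hn : 4 * k - 3 ≤ n)
    (heven : Even (k * n)) (hconn : G.Connected)
    (hδ : ∀ v, k ≤ ndeg G v)
    (hdeg : ∀ u w : V, u ≠ w → ¬ G.Adj u w →
      (n : ℚ) / 2 ≤ (max (ndeg G u) (ndeg G w) : ℚ)) :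
    ∃ H : SimpleGraph V, H ≤ G ∧ ∀ v, ndeg H v = k := by
  classical
  by_contra hno
  have hnd : ∀ v, ndeg G v = fdeg G v := fun v => ncard_neighborSet_eq G v
  subst hcard
  have hδ' : ∀ v, k ≤ fdeg G v := fun v => (hδ v).trans_eq (hnd v)
  obtain ⟨ι, S, T, c, I, hST, hc, hodd, hbar⟩ := exists_barrier G k (by omega) heven (by
    intro v
    have h1 : 0 < fdeg G v := by have := hδ' v; omega
    obtain ⟨w, hw⟩ := Finset.card_pos.1 h1
    exact ⟨w, by simpa using hw⟩) hno
  refine no_barrier G k ((Fintype.card V + 1) / 2) hk (by omega) (by omega) hconn hδ' ?_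
    S T c I hST hc ?_ ?_
  · intro u w hu hw huw
    by_contra hadj
    have := hdeg u w huw hadj
    rw [hnd, hnd, le_max_iff] at this
    rcases this with h | h
    · have h' : (Fintype.card V : ℚ) ≤ 2 * fdeg G u := by linarith
      have h'' : Fintype.card V ≤ 2 * fdeg G u := by exact_mod_cast h'
      omega
    · have h' : (Fintype.card V : ℚ) ≤ 2 * fdeg G w := by linarith
      have h'' : Fintype.card V ≤ 2 * fdeg G w := by exact_mod_cast h'
      omega
  · intro i hi
    by_contra hcon
    rw [Finset.not_nonempty_iff_eq_empty] at hcon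
    have h1 := hodd i hi
    unfold piece at hcon
    rw [hcon] at h1
    simp at h1
  · exact hbar
end

section
/- Let G be a graph and let b ≥ 2 be an integer. Then G contains a [1,b]-factor if and only if for every subset S ⊆ V(G), the number of isolated vertices of G − S satisfies i(G − S) ≤ b|S|. -/
open SimpleGraph Matrix

/-- The number of isolated vertices of the subgraph of `G` induced on the complement of `S`,
i.e. `i(G - S)`. -/
noncomputable def isolCount {V : Type*} (G : SimpleGraph V) (S : Set V) : ℕ :=
  Nat.card {v : ↥Sᶜ // ∀ w, ¬ (G.induce Sᶜ).Adj v w}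

lemma isolCount_eq_ncard {V : Type*} (G : SimpleGraph V) (S : Set V) :
    isolCount G S = {v | v ∉ S ∧ ∀ w, G.Adj v w → w ∈ S}.ncard := by
  unfold isolCount
  rw [← Nat.card_coe_set_eq]
  refine Nat.card_congr ⟨fun v => ⟨v.1.1, v.1.2, fun w hw => ?_⟩,
    fun v => ⟨⟨v.1, v.2.1⟩, fun w hw => w.2 (v.2.2 w.1 hw)⟩, fun v => rfl, fun v => rfl⟩
  by_contra h
  exact v.2 ⟨w, h⟩ hw

/-- Vertices whose out-arc is dropped. -/
inductive DropArc {V : Type*} (f : V → V) : V → Prop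
  | mk (u : V) (h : ∀ w, f w = u → DropArc f w) : DropArc f (f u)

lemma DropArc.not_all {V : Type*} {f : V → V} {v : V} (h : DropArc f v) :
    ¬ ∀ w, f w = v → DropArc f w := by
  induction h with
  | mk u h ih =>
    intro hk
    have hu := hk u rfl
    cases hu with
    | mk w hw => exact ih w rfl hw

/-- The kept arcs form a spanning family with restricted in-degrees. -/
lemma exists_keep {V : Type*} [Finite V] (f : V → V) :
    ∃ K : Set V, (∀ v, v ∉ K → ∃ u ∈ K, f u = v) ∧
      (∀ v ∈ K, ∀ u ∈ K, ∀ u' ∈ K, f u = v → f u' = v → u = u') := by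
  refine ⟨{v | ¬ DropArc f v}, ?_, ?_⟩
  · intro v hv
    simp only [Set.mem_ofPred_eq, not_not] at hv
    cases hv with
    | mk u h => exact ⟨u, fun hu => hu.not_all h, rfl⟩
  · let U : Set V := {v | ¬ DropArc f v ∧ ¬ ∀ w, f w = v → DropArc f w}
    have hU : ∀ v, ¬ DropArc f v → ∀ u, ¬ DropArc f u → f u = v → u ∈ U := by
      intro v hv u hu huv
      refine ⟨hu, fun h => hv ?_⟩
      rw [← huv]
      exact DropArc.mk u h
    have hsub : U ⊆ f '' U := by
      rintro v ⟨hv, hk⟩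
      push Not at hk
      obtain ⟨w, hw, hd⟩ := hk
      exact ⟨w, hU v hv w hd hw, hw⟩
    have hinj : Set.InjOn f U := by
      apply Set.injOn_of_ncard_image_eq _ (Set.toFinite U)
      exact le_antisymm (Set.ncard_image_le (Set.toFinite U))
        (Set.ncard_le_ncard hsub (Set.toFinite _))
    intro v hv u hu u' hu' h h'
    exact hinj (hU v hv u hu h) (hU v hv u' hu' h') (h.trans h'.symm)

lemma exists_arcs {V : Type*} [Fintype V] (G : SimpleGraph V) (b : ℕ) (hb : 2 ≤ b)
    (h : ∀ S : Set V, isolCount G S ≤ b * Nat.card S) :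
    ∃ f : V → V, (∀ v, G.Adj v (f v)) ∧ ∀ w, {v | f v = w}.ncard ≤ b := by
  classical
  have key := (Finset.all_card_le_biUnion_card_iff_exists_injective
    (fun v : V => (G.neighborFinset v) ×ˢ (Finset.univ : Finset (Fin b)))).1 ?_
  · obtain ⟨g, hg, hm⟩ := key
    refine ⟨fun v => (g v).1, fun v => ?_, fun w => ?_⟩
    · have := hm v
      simpa using this
    · have : ({v | (g v).1 = w} : Set V).ncard ≤ (Set.univ : Set (Fin b)).ncard := by
        refine Set.ncard_le_ncard_of_injOn (fun v => (g v).2) (fun _ _ => Set.mem_univ _) ?_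
          (Set.toFinite _)
        intro v hv v' hv' e
        exact hg (Prod.ext (Eq.trans hv (Eq.symm hv')) e)
      simpa using this
  · intro X
    let N : Finset V → Finset V := fun Y => Y.biUnion fun v => G.neighborFinset v
    have e : (X.biUnion fun v => (G.neighborFinset v) ×ˢ (Finset.univ : Finset (Fin b)))
        = N X ×ˢ Finset.univ := by
      ext ⟨x, i⟩
      simp [N]
    rw [e, Finset.card_product, Finset.card_univ, Fintype.card_fin]
    let X' := X.filter fun v => ∀ w ∈ X, ¬ G.Adj v w
    have h1 : X'.card ≤ b * (N X').card := by
      have := h (N X' : Set V)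
      rw [isolCount_eq_ncard] at this
      have h2 : (X' : Set V).ncard ≤
          {v | v ∉ (N X' : Set V) ∧ ∀ w, G.Adj v w → w ∈ (N X' : Set V)}.ncard := by
        refine Set.ncard_le_ncard ?_ (Set.toFinite _)
        intro v hv
        refine ⟨fun hn => ?_, fun w hw => ?_⟩
        · simp only [N, X', Finset.coe_biUnion, Set.mem_iUnion, Finset.mem_coe,
            Finset.mem_filter, mem_neighborFinset] at hn hv
          obtain ⟨u, hu, huv⟩ := hn
          exact hu.2 v hv.1 huv
        · simp only [N, Finset.mem_coe, Finset.mem_biUnion, mem_neighborFinset]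
          exact ⟨v, hv, hw⟩
      rw [Set.ncard_coe_finset] at h2
      have h3 : Nat.card (N X' : Set V) = (N X').card := by
        rw [Nat.card_coe_set_eq, Set.ncard_coe_finset]
      rw [h3] at this
      omega
    have hd : Disjoint (X \ X') (N X') := by
      rw [Finset.disjoint_left]
      intro v hv hn
      simp only [N, X', Finset.mem_biUnion, Finset.mem_filter, mem_neighborFinset] at hn
      obtain ⟨u, hu, huv⟩ := hn
      exact hu.2 v (Finset.mem_sdiff.1 hv).1 huv
    have hs : (X \ X') ∪ N X' ⊆ N X := by
      intro v hv
      simp only [N, X', Finset.mem_union, Finset.mem_sdiff, Finset.mem_biUnion,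
        Finset.mem_filter, mem_neighborFinset] at hv ⊢
      rcases hv with ⟨hv, hn⟩ | ⟨u, hu, huv⟩
      · by_contra hc
        push Not at hc
        exact hn ⟨hv, fun w hw hvw => hc w hw hvw.symm⟩
      · exact ⟨u, hu.1, huv⟩
    have h4 := Finset.card_le_card hs
    rw [Finset.card_union_of_disjoint hd] at h4
    have h5 : (X \ X').card + X'.card = X.card :=
      Finset.card_sdiff_add_card_eq_card (Finset.filter_subset _ _)
    nlinarith

/-- For an integer `b ≥ 2`, a graph `G` contains a `[1,b]`-factor iff `i(G - S) ≤ b·|S|` for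
every vertex subset `S`. -/
theorem one_b_factor_iff_isolCount
    {V : Type*} [Fintype V] (G : SimpleGraph V) (b : ℕ) (hb : 2 ≤ b) :
    (∃ H : SimpleGraph V, H ≤ G ∧ ∀ v, 1 ≤ ndeg H v ∧ ndeg H v ≤ b) ↔
      ∀ S : Set V, isolCount G S ≤ b * Nat.card S := by
  constructor
  · rintro ⟨H, hle, hH⟩ S
    classical
    rw [isolCount_eq_ncard]
    have hsub : {v | v ∉ S ∧ ∀ w, G.Adj v w → w ∈ S} ⊆
        ((S.toFinset.biUnion fun s => (H.neighborSet s).toFinset : Finset V) : Set V) := by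
      rintro v ⟨-, hv⟩
      have h1 : (H.neighborSet v).ncard ≠ 0 := by
        have := (hH v).1
        unfold ndeg at this
        omega
      obtain ⟨w, hw⟩ := Set.nonempty_of_ncard_ne_zero h1
      simp only [Finset.coe_biUnion, Set.mem_iUnion, Finset.mem_coe, Set.mem_toFinset]
      exact ⟨w, hv w (hle hw), H.adj_symm hw⟩
    refine (Set.ncard_le_ncard hsub (Set.toFinite _)).trans ?_
    rw [Set.ncard_coe_finset, Nat.card_coe_set_eq, Set.ncard_eq_toFinset_card', mul_comm]
    refine Finset.card_biUnion_le_card_mul _ _ _ fun s _ => ?_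
    rw [← Set.ncard_eq_toFinset_card']
    exact (hH s).2
  · intro h
    obtain ⟨f, hf, hfb⟩ := exists_arcs G b hb h
    obtain ⟨K, hK1, hK2⟩ := exists_keep f
    refine ⟨{ Adj := fun x y => (x ∈ K ∧ f x = y) ∨ (y ∈ K ∧ f y = x)
              symm := ⟨fun x y h => h.symm⟩
              loopless := ⟨fun x hx => ?_⟩ }, ?_, fun v => ⟨?_, ?_⟩⟩
    · rcases hx with ⟨-, hx⟩ | ⟨-, hx⟩ <;> exact (hf x).ne hx.symm
    · rintro x y (⟨-, rfl⟩ | ⟨-, rfl⟩)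
      · exact hf x
      · exact (hf y).symm
    · unfold ndeg
      rw [Nat.one_le_iff_ne_zero, ← Nat.pos_iff_ne_zero, Set.ncard_pos (Set.toFinite _)]
      by_cases hv : v ∈ K
      · exact ⟨f v, Or.inl ⟨hv, rfl⟩⟩
      · obtain ⟨u, hu, e⟩ := hK1 v hv
        exact ⟨u, Or.inr ⟨hu, e⟩⟩
    · unfold ndeg
      by_cases hv : v ∈ K
      · have h1 : {u | u ∈ K ∧ f u = v}.ncard ≤ 1 := by
          rw [Set.ncard_le_one (Set.toFinite _)]
          intro u hu u' hu'
          exact hK2 v hv u hu.1 u' hu'.1 hu.2 hu'.2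
        refine (Set.ncard_le_ncard (t := insert (f v) {u | u ∈ K ∧ f u = v}) ?_
          (Set.toFinite _)).trans ((Set.ncard_insert_le _ _).trans (by omega))
        rintro u (⟨-, hu⟩ | hu)
        · exact Or.inl hu.symm
        · exact Or.inr hu
      · refine (Set.ncard_le_ncard ?_ (Set.toFinite _)).trans (hfb v)
        rintro u (⟨hu, -⟩ | hu)
        · exact absurd hu hv
        · exact hu.2
end
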